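/- arXiv:2012.10624 — 2 statements merged into one kernel-verified Lean document; each statement's English description precedes it below -/
import Mathlib

section
/- Let k ≥ 6 be an integer. If G is a K_3-free finite simple graph with chromatic number k+1, then G contains k cycles of consecutive lengths. -/
/-- `G` contains a cycle of length `n`. -/
def HasCycleLength {V : Type*} (G : SimpleGraph V) (n : ℕ) : Prop :=
  ∃ (u : V) (c : G.Walk u u), c.IsCycle ∧ c.length = n


/-- `p` restricted to `0..n` is a path of `G` inside `S`. -/
def PS {V : Type*} (G : SimpleGraph V) (S : Set V) (n : ℕ) (p : ℕ → V) : Prop :=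
  (∀ i ≤ n, p i ∈ S) ∧ (∀ i ≤ n, ∀ j ≤ n, p i = p j → i = j) ∧ ∀ i < n, G.Adj (p i) (p (i+1))

theorem walk_of_seq {V : Type*} (G : SimpleGraph V) (p : ℕ → V) (n : ℕ)
    (h : ∀ i < n, G.Adj (p i) (p (i+1))) :
    ∃ w : G.Walk (p 0) (p n), w.length = n ∧ w.support = (List.range (n+1)).map p ∧
      ∀ e ∈ w.edges, ∃ i < n, e = s(p i, p (i+1)) := by
  induction n with
  | zero => exact ⟨SimpleGraph.Walk.nil, by simp, by simp, by simp⟩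
  | succ n ih =>
    obtain ⟨w, h1, h2, h3⟩ := ih (fun i hi => h i (by omega))
    refine ⟨w.concat (h n (by omega)), by simp [h1], ?_, ?_⟩
    · rw [SimpleGraph.Walk.support_concat, h2, List.range_succ (n := n+1)]
      simp
    · intro e he
      rw [SimpleGraph.Walk.edges_concat] at he
      simp only [List.concat_eq_append, List.mem_append, List.mem_singleton] at he
      rcases he with he | he
      · obtain ⟨i, hi, h⟩ := h3 e he
        exact ⟨i, by omega, h⟩
      · exact ⟨n, by omega, he⟩

theorem cycle_of_seq {V : Type*} (G : SimpleGraph V) (S : Set V) (p : ℕ → V) (n : ℕ) (hn : 2 ≤ n)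
    (hp : PS G S n p) (h : G.Adj (p n) (p 0)) : HasCycleLength G (n+1) := by
  obtain ⟨-, hinj, hadj⟩ := hp
  obtain ⟨w, h1, h2, h3⟩ := walk_of_seq G p n hadj
  refine ⟨p n, w.cons h, ?_, by simp [h1]⟩
  rw [SimpleGraph.Walk.cons_isCycle_iff]
  constructor
  · rw [SimpleGraph.Walk.isPath_def, h2]
    refine List.Nodup.map_on ?_ List.nodup_range
    intro x hx y hy hxy
    simp only [List.mem_range] at hx hy
    exact hinj x (by omega) y (by omega) hxy
  · intro he
    obtain ⟨i, hi, h⟩ := h3 _ he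
    rw [Sym2.eq_iff] at h
    rcases h with ⟨h, h'⟩ | ⟨h, h'⟩
    · have := hinj _ le_rfl _ (by omega) h
      omega
    · have a := hinj _ le_rfl _ (by omega) h
      have b := hinj _ (by omega) _ (by omega) h'
      omega

/-- The height at which the ancestor lines of `x` and `y` meet. -/
noncomputable def hgt {V : Type*} (π : V → V) (x y : V) : ℕ := sInf {j | π^[j] x = π^[j] y}

theorem hgt_symm {V : Type*} (π : V → V) (x y : V) : hgt π x y = hgt π y x := by
  unfold hgt; congr 1; ext j; exact eq_comm

section tree
variable {V : Type*} (G : SimpleGraph V) (π : V → V) (lev : V → ℕ) (good : V → Prop) (r : V)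
  (hπ : ∀ v, good v → lev v ≠ 0 → good (π v) ∧ G.Adj v (π v) ∧ lev (π v) + 1 = lev v)
  (hr : ∀ v, good v → lev v = 0 → v = r)
include hπ

theorem anc {L : ℕ} {x : V} (hx : good x) (hL : lev x = L) (j : ℕ) (hj : j ≤ L) :
    good (π^[j] x) ∧ lev (π^[j] x) + j = L := by
  induction j with
  | zero => simpa using ⟨hx, hL⟩
  | succ j ih =>
    obtain ⟨h1, h2⟩ := ih (by omega)
    rw [Function.iterate_succ_apply']
    obtain ⟨a, b, c⟩ := hπ _ h1 (by omega)
    exact ⟨a, by omega⟩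

theorem anc_adj {L : ℕ} {x : V} (hx : good x) (hL : lev x = L) (j : ℕ) (hj : j < L) :
    G.Adj (π^[j] x) (π^[j+1] x) := by
  obtain ⟨h1, h2⟩ := anc G π lev good hπ hx hL j hj.le
  rw [Function.iterate_succ_apply']
  exact (hπ _ h1 (by omega)).2.1

include hr

theorem anc_meet {L : ℕ} {x y : V} (hx : good x) (hL : lev x = L) (hy : good y) (hL' : lev y = L) :
    π^[L] x = π^[L] y := by
  obtain ⟨h1, h2⟩ := anc G π lev good hπ hx hL L le_rfl
  obtain ⟨h3, h4⟩ := anc G π lev good hπ hy hL' L le_rfl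
  rw [hr _ h1 (by omega), hr _ h3 (by omega)]

theorem hgt_spec {L : ℕ} {x y : V} (hx : good x) (hL : lev x = L) (hy : good y) (hL' : lev y = L) :
    π^[hgt π x y] x = π^[hgt π x y] y ∧ hgt π x y ≤ L := by
  have := anc_meet G π lev good r hπ hr hx hL hy hL'
  exact ⟨Nat.sInf_mem (s := {j | π^[j] x = π^[j] y}) ⟨L, this⟩, Nat.sInf_le this⟩

theorem hgt_ultra {L : ℕ} {x y z : V} (hx : good x) (hL : lev x = L) (hy : good y) (hL' : lev y = L)
    (hz : good z) (hL'' : lev z = L) : hgt π x z ≤ max (hgt π x y) (hgt π y z) := by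
  have h1 := (hgt_spec G π lev good r hπ hr hx hL hy hL').1
  have h2 := (hgt_spec G π lev good r hπ hr hy hL' hz hL'').1
  have key : ∀ (a b : V) (i j : ℕ), i ≤ j → π^[i] a = π^[i] b → π^[j] a = π^[j] b := by
    intro a b i j hij h
    obtain ⟨d, rfl⟩ := Nat.exists_eq_add_of_le' hij
    rw [Function.iterate_add_apply, Function.iterate_add_apply, h]
  apply Nat.sInf_le
  exact (key _ _ _ _ (le_max_left _ _) h1).trans (key _ _ _ _ (le_max_right _ _) h2)

theorem cycle_close {L : ℕ} {S : Set V} (hS : ∀ v ∈ S, good v ∧ lev v = L) {t : ℕ} (ht : 1 ≤ t)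
    {p : ℕ → V} (hp : PS G S t p) : HasCycleLength G (t + 2 * hgt π (p 0) (p t)) := by
  obtain ⟨hpS, hinj, hadj⟩ := hp
  obtain ⟨hx, hxL⟩ := hS _ (hpS 0 (by omega))
  obtain ⟨hy, hyL⟩ := hS _ (hpS t (by omega))
  obtain ⟨hm, hhL⟩ := hgt_spec G π lev good r hπ hr hx hxL hy hyL
  have hmin : ∀ j < hgt π (p 0) (p t), π^[j] (p 0) ≠ π^[j] (p t) := by
    intro j hj h
    exact absurd (Nat.sInf_le (s := {j | π^[j] (p 0) = π^[j] (p t)}) h) (not_le.2 hj)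
  set h := hgt π (p 0) (p t) with hh
  have h1 : 1 ≤ h := by
    by_contra hc
    have h0 : h = 0 := by omega
    rw [h0] at hm
    have := hinj 0 (by omega) t le_rfl hm
    omega
  have lx := fun j hj => (anc G π lev good hπ hx hxL j hj).2
  have ly := fun j hj => (anc G π lev good hπ hy hyL j hj).2
  let q : ℕ → V := fun a => if a ≤ t then p a else if a ≤ t + h then π^[a - t] (p t)
    else π^[t + 2 * h - a] (p 0)
  have q1 : ∀ a, a ≤ t → q a = p a := fun a ha => by simp [q, ha]
  have q2 : ∀ a, t ≤ a → a ≤ t + h → q a = π^[a - t] (p t) := by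
    intro a ha ha'
    by_cases e : a = t
    · subst e; simp [q]
    · simp [q, ha', show ¬ a ≤ t by omega]
  have q3 : ∀ a, t + h ≤ a → q a = π^[t + 2 * h - a] (p 0) := by
    intro a ha
    by_cases e : a = t + h
    · rw [q2 a (by omega) (by omega), show a - t = h by omega, show t + 2 * h - a = h by omega]
      exact hm.symm
    · simp [q, show ¬ a ≤ t by omega, show ¬ a ≤ t + h by omega]
  have e : t + 2 * h = (t + 2 * h - 1) + 1 := by omega
  rw [e]
  apply cycle_of_seq G Set.univ q _ (by omega)
  · refine ⟨fun _ _ => trivial, ?_, ?_⟩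
    · have l1 : ∀ a, a ≤ t → lev (q a) = L := fun a ha => by
        rw [q1 a ha]; exact (hS _ (hpS a ha)).2
      have l2 : ∀ a, t ≤ a → a ≤ t + h → lev (q a) + (a - t) = L := fun a ha hb => by
        rw [q2 a ha hb]; exact ly _ (by omega)
      have l3 : ∀ a, t + h ≤ a → lev (q a) + (t + 2 * h - a) = L := fun a ha => by
        rw [q3 a ha]; exact lx _ (by omega)
      have main : ∀ i j, i < j → j ≤ t + 2 * h - 1 → q i ≠ q j := by
        intro i j hij hj hq
        have hl := congrArg lev hq
        by_cases a : j ≤ t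
        · rw [q1 i (by omega), q1 j a] at hq
          have := hinj i (by omega) j a hq
          omega
        by_cases b : j ≤ t + h
        · have := l2 j (by omega) b
          by_cases c : i ≤ t
          · have := l1 i c; omega
          · have := l2 i (by omega) (by omega); omega
        · have := l3 j (by omega)
          by_cases c : i ≤ t
          · have := l1 i c; omega
          by_cases d : i ≤ t + h
          · have := l2 i (by omega) d
            rw [q2 i (by omega) d, q3 j (by omega), show i - t = t + 2 * h - j by omega] at hq
            exact hmin _ (by omega) hq.symm
          · have := l3 i (by omega); omega
      intro i hi j hj hq
      rcases lt_trichotomy i j with hl | hl | hl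
      · exact absurd hq (main i j hl hj)
      · exact hl
      · exact absurd hq.symm (main j i hl hi)
    · intro a ha
      by_cases c : a < t
      · rw [q1 a (by omega), q1 (a+1) (by omega)]; exact hadj a c
      by_cases d : a < t + h
      · rw [q2 a (by omega) (by omega), q2 (a+1) (by omega) (by omega),
          show a + 1 - t = a - t + 1 by omega]
        exact anc_adj G π lev good hπ hy hyL _ (by omega)
      · rw [q3 a (by omega), q3 (a+1) (by omega),
          show t + 2 * h - a = t + 2 * h - (a+1) + 1 by omega]
        exact (anc_adj G π lev good hπ hx hxL _ (by omega)).symm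
  · rw [q3 _ (by omega), q1 0 (by omega), show t + 2 * h - (t + 2 * h - 1) = 0 + 1 by omega]
    exact (anc_adj G π lev good hπ hx hxL 0 (by omega)).symm

end tree

section theta
variable {V : Type*} (G : SimpleGraph V) (S : Set V) (m : ℤ) (c : ℤ → V)
  (hcS : ∀ i, c i ∈ S) (hcinj : ∀ i j, c i = c j ↔ m ∣ i - j)
  (hcadj : ∀ i, G.Adj (c i) (c (i+1)))
include hcS hcinj hcadj

theorem cpath (j : ℤ) (hch : G.Adj (c 0) (c j)) (t : ℕ) (e : ℕ → ℤ) (lo : ℤ)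
    (hw : ∀ a ≤ t, lo ≤ e a ∧ e a < lo + m) (hinj : ∀ a ≤ t, ∀ b ≤ t, e a = e b → a = b)
    (hst : ∀ a < t, e (a+1) = e a + 1 ∨ e a = e (a+1) + 1 ∨ (e a = 0 ∧ e (a+1) = j)) :
    PS G S t (fun a => c (e a)) := by
  refine ⟨fun _ _ => hcS _, ?_, ?_⟩
  · intro a ha b hb hab
    have h1 := (hcinj _ _).1 hab
    have h2 := hw a ha
    have h3 := hw b hb
    apply hinj a ha b hb
    have := Int.eq_zero_of_abs_lt_dvd h1 (by rw [abs_lt]; constructor <;> omega)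
    omega
  · intro a ha
    rcases hst a ha with h | h | ⟨h, h'⟩
    · simp only [h]; exact hcadj _
    · simp only [h]; exact (hcadj _).symm
    · simp only [h, h']; exact hch

theorem theta (hm : 0 < m) (j : ℤ) (hj : 2 ≤ j) (hj' : j ≤ m - 2) (hch : G.Adj (c 0) (c j))
    (f : V → Prop) (x0 y0 : ℤ) (hx0 : f (c x0)) (hy0 : ¬ f (c y0)) :
    (∀ t : ℕ, 1 ≤ t → (t : ℤ) < m → ∃ p, PS G S t p ∧ ¬ (f (p 0) ↔ f (p t))) ∨
    ((∀ i, f (c (i+1)) ↔ ¬ f (c i)) ∧ ¬ (f (c 0) ↔ f (c j))) := by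
  by_contra hcon
  rw [not_or] at hcon
  obtain ⟨hcon1, hcon2⟩ := hcon
  push Not at hcon1
  obtain ⟨t, ht1, htm, hno⟩ := hcon1
  apply hcon2
  set F : ℤ → Prop := fun i => f (c i) with hF
  have P : ∀ (e : ℕ → ℤ) (lo : ℤ)
    (_ : ∀ a ≤ t, lo ≤ e a ∧ e a < lo + m) (_ : ∀ a ≤ t, ∀ b ≤ t, e a = e b → a = b)
    (_ : ∀ a < t, e (a+1) = e a + 1 ∨ e a = e (a+1) + 1 ∨ (e a = 0 ∧ e (a+1) = j)),
    (F (e 0) ↔ F (e t)) := fun e lo h1 h2 h3 =>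
    hno _ (cpath G S m c hcS hcinj hcadj j hch t e lo h1 h2 h3)
  -- periods
  have pm : ∀ i, F (i + m) ↔ F i := fun i => by
    simp only [hF]; rw [(hcinj (i+m) i).2 (by simp)]
  have pt : ∀ i, F (i + t) ↔ F i := fun i => by
    have := P (fun a => i + a) i (fun a ha => by constructor <;> omega)
      (fun a _ b _ h => by omega) (fun a ha => Or.inl (by push_cast; ring))
    simpa using this.symm
  let Per : AddSubgroup ℤ :=
    { carrier := {a | ∀ i, F (i + a) ↔ F i}
      zero_mem' := fun i => by simp
      add_mem' := fun {a b} ha hb i => by rw [← add_assoc, hb, ha]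
      neg_mem' := fun {a} ha i => by rw [← ha (i + -a)]; simp }
  have hPer : ∀ a, a ∈ Per ↔ ∀ i, F (i + a) ↔ F i := fun a => Iff.rfl
  obtain ⟨g0, hg0⟩ := Int.subgroup_cyclic Per
  obtain ⟨g, hg, hgpos⟩ : ∃ g : ℤ, (∀ a, a ∈ Per ↔ g ∣ a) ∧ 0 < g := by
    refine ⟨|g0|, fun a => ?_, ?_⟩
    · rw [hg0, abs_dvd, AddSubgroup.mem_closure_singleton]
      constructor
      · rintro ⟨n, rfl⟩; simp
      · rintro ⟨n, rfl⟩; exact ⟨n, by simp [mul_comm]⟩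
    · rw [abs_pos]
      rintro rfl
      have : m ∈ Per := pm
      rw [hg0, AddSubgroup.mem_closure_singleton] at this
      obtain ⟨n, hn⟩ := this
      simp at hn; omega
  have gm : g ∣ m := (hg m).1 pm
  have gt : g ∣ (t:ℤ) := (hg t).1 pt
  have gle1 : g ≤ t := Int.le_of_dvd (by omega) gt
  have gle2 : g ≤ m - t := Int.le_of_dvd (by omega) (dvd_sub gm gt)
  have Fg : ∀ a b, g ∣ a - b → (F a ↔ F b) := fun a b h => by
    have := (hPer _).1 ((hg _).2 h) b
    simpa using this
  -- representative in a window
  have rep : ∀ (i s0 : ℤ), ∃ s, s0 ≤ s ∧ s < s0 + g ∧ g ∣ i - s := by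
    intro i s0
    refine ⟨s0 + (i - s0) % g, ?_, ?_, ?_⟩
    · have := Int.emod_nonneg (i - s0) hgpos.ne'; omega
    · have := Int.emod_lt_of_pos (i - s0) hgpos; omega
    · have := Int.dvd_self_sub_emod (x := i - s0) (m := g)
      convert this using 1 <;> first | rfl | (push_cast; ring)
  have gj : g ≤ j := by
    by_contra hlt
    have : (j - 1) ∈ Per := by
      rw [hPer]
      intro i
      obtain ⟨s, hs1, hs2, hs3⟩ := rep (-i) 0
      have := P (fun a => if (a:ℤ) ≤ s then -s + a else j + (a - s - 1)) (-s)
        (fun a ha => by split_ifs <;> constructor <;> omega)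
        (fun a ha b hb h => by
          split_ifs at h <;> omega)
        (fun a ha => by push_cast; split_ifs <;> omega)
      simp only [show ((0:ℕ):ℤ) ≤ s by simpa using hs1, if_true, show ¬ (t:ℤ) ≤ s by omega,
        if_false] at this
      rw [Fg (i + (j-1)) (j + (t - s - 1)) ?_, ← this, Fg i]
      · have := dvd_neg.2 hs3
        convert this using 1 <;> first | rfl | (push_cast; ring)
      · have := dvd_sub (dvd_neg.2 hs3) gt
        convert this using 1 <;> first | rfl | (push_cast; ring)
    have := Int.le_of_dvd (by omega) ((hg _).1 this)
    omega
  have gj' : g ≤ m - j := by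
    by_contra hlt
    have : (j + 1) ∈ Per := by
      rw [hPer]
      intro i
      obtain ⟨s, hs1, hs2, hs3⟩ := rep i 0
      have := P (fun a => if (a:ℤ) ≤ s then s - a else j - (a - s - 1)) 0
        (fun a ha => by split_ifs <;> constructor <;> omega)
        (fun a ha b hb h => by
          split_ifs at h <;> omega)
        (fun a ha => by push_cast; split_ifs <;> omega)
      simp only [show ((0:ℕ):ℤ) ≤ s by simpa using hs1, if_true, show ¬ (t:ℤ) ≤ s by omega,
        if_false] at this
      rw [Fg (i + (j+1)) (j - (t - s - 1)) ?_, ← this, Fg i]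
      · convert hs3 using 1 <;> first | rfl | (push_cast; ring)
      · have := dvd_add hs3 gt
        convert this using 1 <;> first | rfl | (push_cast; ring)
    have := Int.le_of_dvd (by omega) (dvd_sub gm ((hg _).1 this))
    omega
  have r1 : ∀ i, F i ↔ F (j - 1 - i) := by
    intro i
    obtain ⟨s, hs1, hs2, hs3⟩ := rep i (max 0 (t - m + j))
    have := P (fun a => if (a:ℤ) ≤ s then s - a else j + (a - s - 1)) 0
      (fun a ha => by split_ifs <;> constructor <;> omega)
      (fun a ha b hb h => by
        split_ifs at h <;> omega)
      (fun a ha => by push_cast; split_ifs <;> omega)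
    simp only [show ((0:ℕ):ℤ) ≤ s by simp; omega, if_true, show ¬ (t:ℤ) ≤ s by omega,
      if_false] at this
    rw [Fg (j - 1 - i) (j + (t - s - 1)) ?_, ← this, Fg i]
    · convert hs3 using 1 <;> first | rfl | (push_cast; ring)
    · have := dvd_sub (dvd_neg.2 hs3) gt
      convert this using 1 <;> first | rfl | (push_cast; ring)
  have r2 : ∀ i, F i ↔ F (j + 1 - i) := by
    intro i
    obtain ⟨s, hs1, hs2, hs3⟩ := rep (-i) (max 0 (t - j))
    have := P (fun a => if (a:ℤ) ≤ s then -s + a else j - (a - s - 1)) (j - m + 1)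
      (fun a ha => by split_ifs <;> constructor <;> omega)
      (fun a ha b hb h => by
        split_ifs at h <;> omega)
      (fun a ha => by push_cast; split_ifs <;> omega)
    simp only [show ((0:ℕ):ℤ) ≤ s by simp; omega, if_true, show ¬ (t:ℤ) ≤ s by omega,
      if_false] at this
    rw [Fg (j + 1 - i) (j - (t - s - 1)) ?_, ← this, Fg i]
    · have := dvd_neg.2 hs3
      convert this using 1 <;> first | rfl | (push_cast; ring)
    · have := dvd_add hs3 gt
      convert this using 1 <;> first | rfl | (push_cast; ring)
  have p2 : (2:ℤ) ∈ Per := by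
    rw [hPer]
    intro i
    rw [r1 i, r2 (j - 1 - i)]
    apply iff_of_eq; congr 1; ring
  have g2 : g ∣ 2 := (hg 2).1 p2
  have g1 : ¬ g ∣ 1 := by
    intro h
    exact hy0 ((Fg x0 y0 (h.trans (one_dvd _))).1 hx0)
  have par : ∀ a b : ℤ, (a - b) % 2 = 0 → (F a ↔ F b) := fun a b h =>
    Fg a b (g2.trans (Int.dvd_of_emod_eq_zero h))
  have alt : ∀ i, F (i+1) ↔ ¬ F i := by
    intro i
    by_contra hcc
    have hii : F (i+1) ↔ F i := by tauto
    apply hy0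
    have hx : F x0 ↔ F i := by
      rcases Int.emod_two_eq_zero_or_one (x0 - i) with h | h
      · exact par _ _ h
      · rw [← hii]; exact par _ _ (by omega)
    have hy : F y0 ↔ F i := by
      rcases Int.emod_two_eq_zero_or_one (y0 - i) with h | h
      · exact par _ _ h
      · rw [← hii]; exact par _ _ (by omega)
    exact hy.2 (hx.1 hx0)
  refine ⟨alt, ?_⟩
  have a1 := r1 0
  have a2 := alt (j - 1)
  simp only [sub_zero, sub_add_cancel] at a1 a2
  change ¬ (F 0 ↔ F j)
  tauto

theorem lolli (n : ℕ) (p : ℕ → V) (i0 : ℤ) (h0 : p 0 = c i0) (hp : PS G S n p)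
    (hout : ∀ a, 1 ≤ a → a ≤ n → ∀ i, p a ≠ c i) (s : ℕ) (hs : (s : ℤ) < m) :
    ∃ q, PS G S (n + s) q ∧ q 0 = p n ∧ q (n + s) = c (i0 + s) := by
  obtain ⟨h1, h2, h3⟩ := hp
  let q : ℕ → V := fun a => if a ≤ n then p (n - a) else c (i0 + (a - n : ℕ))
  have q1 : ∀ a, a ≤ n → q a = p (n - a) := fun a ha => by simp [q, ha]
  have q2 : ∀ a, n ≤ a → q a = c (i0 + (a - n : ℕ)) := by
    intro a ha
    by_cases e : a = n
    · subst e; simp [q, h0]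
    · simp [q, show ¬ a ≤ n by omega]
  refine ⟨q, ⟨?_, ?_, ?_⟩, by rw [q1 0 (by omega)]; simp, by rw [q2 _ (by omega)]; simp⟩
  · intro a ha
    by_cases e : a ≤ n
    · rw [q1 a e]; exact h1 _ (by omega)
    · rw [q2 a (by omega)]; exact hcS _
  · have main : ∀ a b, a < b → b ≤ n + s → q a ≠ q b := by
      intro a b hab hb h
      by_cases e : b ≤ n
      · rw [q1 a (by omega), q1 b e] at h
        have := h2 _ (by omega) _ (by omega) h
        omega
      by_cases e' : a < n
      · rw [q1 a (by omega), q2 b (by omega)] at h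
        exact hout _ (by omega) (by omega) _ h
      · rw [q2 a (by omega), q2 b (by omega), hcinj] at h
        have := Int.eq_zero_of_abs_lt_dvd h (by rw [abs_lt]; constructor <;> omega)
        omega
    intro i hi j hj hq
    rcases lt_trichotomy i j with hl | hl | hl
    · exact absurd hq (main i j hl hj)
    · exact hl
    · exact absurd hq.symm (main j i hl hi)
  · intro a ha
    by_cases e : a < n
    · rw [q1 a (by omega), q1 (a+1) (by omega), show n - a = n - (a+1) + 1 by omega]
      exact (h3 _ (by omega)).symm
    · rw [q2 a (by omega), q2 (a+1) (by omega), show a + 1 - n = a - n + 1 by omega]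
      push_cast
      rw [← add_assoc]
      exact hcadj _

end theta

section longcycle
open Classical in
/-- Neighbours of `v` in `S`. -/
noncomputable def Nb {V : Type*} (G : SimpleGraph V) (S : Finset V) (v : V) : Finset V :=
  S.filter (fun w => G.Adj v w)

theorem mem_Nb {V : Type*} (G : SimpleGraph V) (S : Finset V) (v w : V) :
    w ∈ Nb G S v ↔ w ∈ S ∧ G.Adj v w := by simp [Nb]

variable {V : Type*} [DecidableEq V] (G : SimpleGraph V) (S : Finset V)
  (htf : ∀ a b c, G.Adj a b → G.Adj b c → G.Adj a c → False)
  (d : ℕ) (hd : 3 ≤ d) (hdeg : ∀ v ∈ S, d ≤ (Nb G S v).card)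
  (hanti : ∀ u ∈ S, ∀ v ∈ S, u ≠ v → ¬ Nb G S u ⊆ Nb G S v)
include htf hd hdeg hanti

theorem E_indep (E W : Finset V) (hEW : E ⊆ W) (hWS : W ⊆ S) (hW : W.card ≤ 2 * d + 1)
    (hN : ∀ e ∈ E, Nb G S e ⊆ W) (hE : ∀ e ∈ E, d ≤ (E \ Nb G S e).card) :
    ∀ e ∈ E, ∀ e' ∈ E, ¬ G.Adj e e' := by
  intro e he e' he' hadj
  have hES : ∀ v ∈ E, v ∈ S := fun v hv => hWS (hEW hv)
  obtain ⟨X, hX⟩ : ∃ X, X = Nb G S e' := ⟨_, rfl⟩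
  obtain ⟨Y, hY⟩ : ∃ Y, Y = Nb G S e := ⟨_, rfl⟩
  have mX : ∀ w, w ∈ X ↔ w ∈ S ∧ G.Adj e' w := fun w => by rw [hX, mem_Nb]
  have mY : ∀ w, w ∈ Y ↔ w ∈ S ∧ G.Adj e w := fun w => by rw [hY, mem_Nb]
  have eX : e ∈ X := (mX e).2 ⟨hES e he, hadj.symm⟩
  have eY : e' ∈ Y := (mY e').2 ⟨hES e' he', hadj⟩
  have XW : X ⊆ W := hX ▸ hN e' he'
  have YW : Y ⊆ W := hY ▸ hN e he
  have dis : Disjoint X Y := by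
    rw [Finset.disjoint_left]
    intro w hw hw'
    exact htf e e' w hadj ((mX w).1 hw).2 ((mY w).1 hw').2
  have hXd : d ≤ X.card := hX ▸ hdeg e' (hES e' he')
  have hYd : d ≤ Y.card := hY ▸ hdeg e (hES e he)
  have cXY : (X ∪ Y).card = X.card + Y.card := Finset.card_union_of_disjoint dis
  have hsub : X ∪ Y ⊆ W := Finset.union_subset XW YW
  have cW := Finset.card_le_card hsub
  have cR := Finset.card_sdiff_add_card_eq_card hsub
  have hEY : d ≤ (E \ Y).card := hY ▸ hE e he
  have hEX : d ≤ (E \ X).card := hX ▸ hE e' he'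
  -- independence of X, Y
  have iX : ∀ a ∈ X, ∀ b ∈ X, ¬ G.Adj a b := fun a ha b hb h =>
    htf e' a b ((mX a).1 ha).2 h ((mX b).1 hb).2
  have iY : ∀ a ∈ Y, ∀ b ∈ Y, ¬ G.Adj a b := fun a ha b hb h =>
    htf e a b ((mY a).1 ha).2 h ((mY b).1 hb).2
  rcases Nat.eq_zero_or_pos (W \ (X ∪ Y)).card with hR | hR
  · have hR' : ∀ w ∈ W, w ∈ X ∨ w ∈ Y := by
      intro w hw
      by_contra hc
      rw [Finset.card_eq_zero] at hR
      have : w ∈ W \ (X ∪ Y) := by simp [hw]; tauto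
      rw [hR] at this
      simp at this
    obtain ⟨e2, h2, h2e⟩ := Finset.exists_mem_ne (by omega : 1 < (E \ Y).card) e
    rw [Finset.mem_sdiff] at h2
    have h2X : e2 ∈ X := (hR' e2 (hEW h2.1)).resolve_right h2.2
    apply hanti e2 (hES e2 h2.1) e (hES e he) h2e
    intro w hw
    rw [← hY]
    refine (hR' w (hN e2 h2.1 hw)).resolve_left (fun hwX => ?_)
    exact iX e2 h2X w hwX ((mem_Nb _ _ _ _).1 hw).2
  · obtain ⟨x, hx⟩ := Finset.card_eq_one.1 (by omega : (W \ (X ∪ Y)).card = 1)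
    have hR' : ∀ w ∈ W, w ∈ X ∨ w ∈ Y ∨ w = x := by
      intro w hw
      by_contra hc
      have : w ∈ W \ (X ∪ Y) := by simp [hw]; tauto
      rw [hx] at this
      simp at this
      tauto
    have hxm : x ∈ W \ (X ∪ Y) := by rw [hx]; simp
    have cX : X.card = d := by omega
    have cY : Y.card = d := by omega
    have kX : ∀ v ∈ E, v ∈ X → v ≠ e → G.Adj v x := by
      intro v hv hvX hve
      by_contra hc
      apply hanti v (hES v hv) e (hES e he) hve
      intro w hw
      rw [← hY]
      have hw' := ((mem_Nb _ _ _ _).1 hw).2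
      rcases hR' w (hN v hv hw) with h | h | h
      · exact absurd hw' (iX v hvX w h)
      · exact h
      · subst h; exact absurd hw' hc
    have kY : ∀ v ∈ E, v ∈ Y → v ≠ e' → G.Adj v x := by
      intro v hv hvX hve
      by_contra hc
      apply hanti v (hES v hv) e' (hES e' he') hve
      intro w hw
      rw [← hX]
      have hw' := ((mem_Nb _ _ _ _).1 hw).2
      rcases hR' w (hN v hv hw) with h | h | h
      · exact h
      · exact absurd hw' (iY v hvX w h)
      · subst h; exact absurd hw' hc
    obtain ⟨e2, e2E, e2X, e2e⟩ : ∃ v ∈ E, v ∈ X ∧ v ≠ e := by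
      by_contra hc
      push Not at hc
      have : E \ Y ⊆ {e, x} := by
        intro v hv
        rw [Finset.mem_sdiff] at hv
        simp only [Finset.mem_insert, Finset.mem_singleton]
        rcases hR' v (hEW hv.1) with h | h | h
        · exact Or.inl (hc v hv.1 h)
        · exact absurd h hv.2
        · exact Or.inr h
      have := (Finset.card_le_card this).trans Finset.card_le_two
      omega
    obtain ⟨f2, f2E, f2Y, f2e⟩ : ∃ v ∈ E, v ∈ Y ∧ v ≠ e' := by
      by_contra hc
      push Not at hc
      have : E \ X ⊆ {e', x} := by
        intro v hv
        rw [Finset.mem_sdiff] at hv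
        simp only [Finset.mem_insert, Finset.mem_singleton]
        rcases hR' v (hEW hv.1) with h | h | h
        · exact absurd h hv.2
        · exact Or.inl (hc v hv.1 h)
        · exact Or.inr h
      have := (Finset.card_le_card this).trans Finset.card_le_two
      omega
    have xX : x ∉ X := by simp at hxm; tauto
    have xY : x ∉ Y := by simp at hxm; tauto
    have NX : ∀ v ∈ E, v ∈ X → v ≠ e → Nb G S v = (insert x Y).erase f2 := by
      intro v hv hvX hve
      apply Finset.eq_of_subset_of_card_le
      · intro w hw
        have hw' := ((mem_Nb _ _ _ _).1 hw).2
        rw [Finset.mem_erase, Finset.mem_insert]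
        constructor
        · rintro rfl
          exact htf v w x hw' (kY w f2E f2Y f2e) (kX v hv hvX hve)
        · rcases hR' w (hN v hv hw) with h | h | h
          · exact absurd hw' (iX v hvX w h)
          · exact Or.inr h
          · exact Or.inl h
      · rw [Finset.card_erase_of_mem (by simp [f2Y]), Finset.card_insert_of_notMem xY, cY]
        exact hdeg v (hES v hv)
    have NY : Nb G S f2 = (insert x X).erase e2 := by
      apply Finset.eq_of_subset_of_card_le
      · intro w hw
        have hw' := ((mem_Nb _ _ _ _).1 hw).2
        rw [Finset.mem_erase, Finset.mem_insert]
        constructor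
        · rintro rfl
          exact htf f2 w x hw' (kX w e2E e2X e2e) (kY f2 f2E f2Y f2e)
        · rcases hR' w (hN f2 f2E hw) with h | h | h
          · exact Or.inr h
          · exact absurd hw' (iY f2 f2Y w h)
          · exact Or.inl h
      · rw [Finset.card_erase_of_mem (by simp [e2X]), Finset.card_insert_of_notMem xX, cX]
        exact hdeg f2 (hES f2 f2E)
    have uX : ∀ v ∈ E, v ∈ X → v ≠ e → v = e2 := by
      intro v hv hvX hve
      by_contra hne
      apply hanti v (hES v hv) e2 (hES e2 e2E) hne
      rw [NX v hv hvX hve, NX e2 e2E e2X e2e]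
    have xE : x ∈ E := by
      by_contra hxE
      have : E \ Y ⊆ {e, e2} := by
        intro v hv
        rw [Finset.mem_sdiff] at hv
        simp only [Finset.mem_insert, Finset.mem_singleton]
        rcases hR' v (hEW hv.1) with h | h | h
        · by_cases hve : v = e
          · exact Or.inl hve
          · exact Or.inr (uX v hv.1 h hve)
        · exact absurd h hv.2
        · subst h; exact absurd hv.1 hxE
      have := (Finset.card_le_card this).trans Finset.card_le_two
      omega
    have hfin : Nb G S x ⊆ {e2, f2} := by
      intro w hw
      have hw' := ((mem_Nb _ _ _ _).1 hw).2
      simp only [Finset.mem_insert, Finset.mem_singleton]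
      rcases hR' w (hN x xE hw) with h | h | h
      · left
        by_contra hne
        have : w ∈ Nb G S f2 := by rw [NY]; simp [hne, h]
        exact htf f2 w x ((mem_Nb _ _ _ _).1 this).2 hw'.symm (kY f2 f2E f2Y f2e)
      · right
        by_contra hne
        have : w ∈ Nb G S e2 := by rw [NX e2 e2E e2X e2e]; simp [hne, h]
        exact htf e2 w x ((mem_Nb _ _ _ _).1 this).2 hw'.symm (kX e2 e2E e2X e2e)
      · subst h; exact absurd hw' (G.loopless.irrefl w)
    have h1 := (Finset.card_le_card hfin).trans Finset.card_le_two
    have h2 := hdeg x (hES x xE)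
    omega

theorem F_indep (E W : Finset V) (hEW : E ⊆ W) (hWS : W ⊆ S) (hW : W.card ≤ 2 * d + 1)
    (hne : E.Nonempty)
    (hN : ∀ e ∈ E, Nb G S e ⊆ W) (hE : ∀ e ∈ E, d ≤ (E \ Nb G S e).card) :
    W.card = 2 * d + 1 ∧ ∀ f ∈ W \ E, ∀ f' ∈ W \ E, ¬ G.Adj f f' := by
  have hind := E_indep G S htf d hd hdeg hanti E W hEW hWS hW hN hE
  have hES : ∀ v ∈ E, v ∈ S := fun v hv => hWS (hEW hv)
  obtain ⟨e0, he0⟩ := hne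
  have cE : d ≤ E.card := (hE e0 he0).trans (Finset.card_le_card Finset.sdiff_subset)
  have cF := Finset.card_sdiff_add_card_eq_card hEW
  have hNF : ∀ e ∈ E, Nb G S e ⊆ W \ E := by
    intro e he w hw
    rw [Finset.mem_sdiff]
    exact ⟨hN e he hw, fun hwE => hind e he w hwE ((mem_Nb _ _ _ _).1 hw).2⟩
  have key : ∀ T : Finset V, T.card ≤ d → ∀ e ∈ E, ∀ e' ∈ E, e ≠ e' → Nb G S e ⊆ T →
      Nb G S e' ⊆ T → False := by
    intro T hT e he e' he' hee h h'
    have h1 := Finset.eq_of_subset_of_card_le h (hT.trans (hdeg e (hES e he)))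
    have h2 := Finset.eq_of_subset_of_card_le h' (hT.trans (hdeg e' (hES e' he')))
    exact hanti e (hES e he) e' (hES e' he') hee (by rw [h1, h2])
  have cF2 : d < (W \ E).card := by
    by_contra hc
    obtain ⟨e1, he1, hne⟩ := Finset.exists_mem_ne (by omega : 1 < E.card) e0
    exact key (W \ E) (by omega) e1 he1 e0 he0 hne (hNF e1 he1) (hNF e0 he0)
  refine ⟨by omega, ?_⟩
  intro f hf f' hf' hadj
  classical
  have hpig := Finset.exists_ne_map_eq_of_card_lt_of_maps_to (s := E) (t := {f, f'})
    (f := fun e => if G.Adj e f then f' else f)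
    (by have := Finset.card_le_two (a := f) (b := f'); omega)
    (by intro e he; simp only [Finset.coe_insert, Finset.coe_singleton]; split_ifs <;> simp)
  obtain ⟨e, he, e', he', hee, hg⟩ := hpig
  have miss : ∀ e, ¬ G.Adj e (if G.Adj e f then f' else f) := by
    intro e h
    split_ifs at h with h1
    · exact htf e f f' h1 hadj h
    · exact h1 h
  set g := (if G.Adj e f then f' else f) with hgdef
  have gF : g ∈ W \ E := by rw [hgdef]; split_ifs <;> assumption
  have m1 : ¬ G.Adj e g := miss e
  have m2 : ¬ G.Adj e' g := by
    have := miss e'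
    rwa [← hg] at this
  refine key ((W \ E).erase g) ?_ e he e' he' hee ?_ ?_
  · rw [Finset.card_erase_of_mem gF]; omega
  · intro w hw
    rw [Finset.mem_erase]
    refine ⟨?_, hNF e he hw⟩
    rintro rfl
    exact m1 ((mem_Nb _ _ _ _).1 hw).2
  · intro w hw
    rw [Finset.mem_erase]
    refine ⟨?_, hNF e' he' hw⟩
    rintro rfl
    exact m2 ((mem_Nb _ _ _ _).1 hw).2

theorem longcycle (hne : S.Nonempty) : ∃ (m j : ℕ) (p : ℕ → V), 2 * d + 1 ≤ m ∧ PS G S m p ∧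
    G.Adj (p 0) (p m) ∧ 2 ≤ j ∧ j + 1 ≤ m ∧ G.Adj (p 0) (p j) := by
  have cardle : ∀ n p, PS G (S : Set V) n p → (Finset.image p (Finset.range (n+1))).card = n + 1 := by
    intro n p hp
    rw [Finset.card_image_of_injOn, Finset.card_range]
    intro a ha b hb hab
    simp at ha hb
    exact hp.2.1 a (by omega) b (by omega) hab
  have bdd : ∀ n p, PS G (S : Set V) n p → n ≤ S.card := by
    intro n p hp
    have h1 := cardle n p hp
    have h2 : (Finset.image p (Finset.range (n+1))) ⊆ S := by
      intro v hv
      simp only [Finset.mem_image, Finset.mem_range] at hv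
      obtain ⟨a, ha, rfl⟩ := hv
      exact hp.1 a (by omega)
    have := Finset.card_le_card h2
    omega
  obtain ⟨n, ⟨p0, hp0⟩, nmax⟩ : ∃ n, (∃ p, PS G (S : Set V) n p) ∧
      ∀ n', (∃ p, PS G (S : Set V) n' p) → n' ≤ n := by
    have hb : BddAbove {n | ∃ p, PS G (S : Set V) n p} := ⟨S.card, fun n ⟨p, hp⟩ => bdd n p hp⟩
    refine ⟨sSup {n | ∃ p, PS G (S : Set V) n p}, Nat.sSup_mem ?_ hb, fun n' h => le_csSup hb h⟩
    obtain ⟨v, hv⟩ := hne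
    refine ⟨0, fun _ => v, fun _ _ => hv, fun i hi j hj _ => by omega, fun i hi => by omega⟩
  have ext : ∀ p, PS G (S : Set V) n p → ∀ w ∈ Nb G S (p 0), ∃ i, i ≤ n ∧ p i = w := by
    intro p hp w hw
    by_contra hc
    push Not at hc
    rw [mem_Nb] at hw
    have := nmax (n+1) ⟨fun a => Nat.casesOn a w p, ?_, ?_, ?_⟩
    · omega
    · intro i hi
      cases i with
      | zero => exact hw.1
      | succ i => exact hp.1 i (by omega)
    · intro i hi j hj hij
      cases i with
      | zero =>
        cases j with
        | zero => rfl
        | succ j => exact absurd hij.symm (hc j (by omega))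
      | succ i =>
        cases j with
        | zero => exact absurd hij (hc i (by omega))
        | succ j => rw [hp.2.1 i (by omega) j (by omega) hij]
    · intro i hi
      cases i with
      | zero => exact hw.2.symm
      | succ i => exact hp.2.2 i (by omega)
  obtain ⟨m, ⟨p, hp, hmn, hpm⟩, mmax⟩ : ∃ m, (∃ p, PS G (S : Set V) n p ∧ m ≤ n ∧ G.Adj (p 0) (p m)) ∧
      ∀ m', (∃ p, PS G (S : Set V) n p ∧ m' ≤ n ∧ G.Adj (p 0) (p m')) → m' ≤ m := by
    have hb : BddAbove {m | ∃ p, PS G (S : Set V) n p ∧ m ≤ n ∧ G.Adj (p 0) (p m)} :=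
      ⟨n, fun m ⟨p, hp, h, _⟩ => h⟩
    refine ⟨_, Nat.sSup_mem ?_ hb, fun n' h => le_csSup hb h⟩
    have h1 := hdeg (p0 0) (hp0.1 0 (by omega))
    obtain ⟨w, hw⟩ := Finset.card_pos.1 (by omega : 0 < (Nb G S (p0 0)).card)
    obtain ⟨i, hi, rfl⟩ := ext p0 hp0 w hw
    exact ⟨i, p0, hp0, hi, ((mem_Nb _ _ _ _).1 hw).2⟩
  have ext' : ∀ p, PS G (S : Set V) n p → ∀ w ∈ Nb G S (p 0), ∃ i, i ≤ m ∧ p i = w := by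
    intro p hp w hw
    obtain ⟨i, hi, rfl⟩ := ext p hp w hw
    exact ⟨i, mmax i ⟨p, hp, hi, ((mem_Nb _ _ _ _).1 hw).2⟩, rfl⟩
  have hres : ∀ p, PS G (S : Set V) n p → PS G (S : Set V) m p := fun p hp =>
    ⟨fun i hi => hp.1 i (by omega), fun i hi j hj => hp.2.1 i (by omega) j (by omega),
      fun i hi => hp.2.2 i (by omega)⟩
  have hbig : 2 * d + 1 ≤ m := by
    by_contra hsmall
    classical
    set W := Finset.image p (Finset.range (m+1)) with hWdef
    set E := W.filter (fun e => ∃ q, PS G (S : Set V) n q ∧ q 0 = e ∧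
      Finset.image q (Finset.range (m+1)) = W) with hEdef
    have cW : W.card = m + 1 := cardle m p (hres p hp)
    have hEW : E ⊆ W := Finset.filter_subset _ _
    have hWS : W ⊆ S := by
      intro v hv
      simp only [hWdef, Finset.mem_image, Finset.mem_range] at hv
      obtain ⟨a, ha, rfl⟩ := hv
      exact hp.1 a (by omega)
    have hN : ∀ e ∈ E, Nb G S e ⊆ W := by
      intro e he w hw
      obtain ⟨-, q, hq, rfl, hqW⟩ := Finset.mem_filter.1 he
      obtain ⟨i, hi, rfl⟩ := ext' q hq w hw
      rw [← hqW]
      exact Finset.mem_image_of_mem _ (Finset.mem_range.2 (by omega))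
    have hE : ∀ e ∈ E, d ≤ (E \ Nb G S e).card := by
      intro e he
      obtain ⟨heW, q, hq, rfl, hqW⟩ := Finset.mem_filter.1 he
      set I := (Finset.range (m+1)).filter (fun i => G.Adj (q 0) (q i)) with hI
      have h1 : Nb G S (q 0) ⊆ I.image q := by
        intro w hw
        obtain ⟨i, hi, rfl⟩ := ext' q hq w hw
        refine Finset.mem_image_of_mem _ ?_
        rw [hI, Finset.mem_filter, Finset.mem_range]
        exact ⟨by omega, ((mem_Nb _ _ _ _).1 hw).2⟩
      have h2 : d ≤ I.card := (hdeg _ (hWS heW)).trans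
        ((Finset.card_le_card h1).trans Finset.card_image_le)
      have hpos : ∀ i ∈ I, 1 ≤ i ∧ i ≤ m ∧ G.Adj (q 0) (q i) := by
        intro i hi
        rw [hI, Finset.mem_filter, Finset.mem_range] at hi
        refine ⟨?_, by omega, hi.2⟩
        by_contra h0
        have h0 : i = 0 := by omega
        rw [h0] at hi
        exact G.loopless.irrefl _ hi.2
      have h3 : (I.image (fun i => q (i-1))).card = I.card := by
        apply Finset.card_image_of_injOn
        intro a ha b hb hab
        have := hpos a ha
        have := hpos b hb
        have := hq.2.1 (a-1) (by omega) (b-1) (by omega) hab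
        omega
      refine h2.trans (h3 ▸ Finset.card_le_card ?_)
      intro v hv
      obtain ⟨i, hi, rfl⟩ := Finset.mem_image.1 hv
      obtain ⟨i1, im, iadj⟩ := hpos i hi
      have hmemW : ∀ a, a ≤ m → q a ∈ W := fun a ha => by
        rw [← hqW]
        exact Finset.mem_image_of_mem _ (Finset.mem_range.2 (by omega))
      rw [Finset.mem_sdiff]
      constructor
      · rw [hEdef, Finset.mem_filter]
        refine ⟨hmemW _ (by omega), ?_⟩
        let σ : ℕ → ℕ := fun a => if a < i then i - 1 - a else a
        have hσ : ∀ a, (a < i → σ a = i - 1 - a) ∧ (¬ a < i → σ a = a) := fun a =>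
          ⟨fun h => by simp [σ, h], fun h => by simp [σ, h]⟩
        have hσle : ∀ N, i ≤ N + 1 → ∀ a ≤ N, σ a ≤ N := by
          intro N hN a ha
          have := hσ a
          omega
        have hσσ : ∀ a, σ (σ a) = a := by
          intro a
          have := hσ a
          have := hσ (σ a)
          omega
        refine ⟨fun a => q (σ a), ⟨?_, ?_, ?_⟩, ?_, ?_⟩
        · intro a ha
          exact hq.1 _ (hσle n (by omega) a ha)
        · intro a ha b hb hab
          have := hq.2.1 _ (hσle n (by omega) a ha) _ (hσle n (by omega) b hb) hab
          rw [← hσσ a, this, hσσ]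
        · intro a ha
          by_cases c1 : a + 1 < i
          · simp only [(hσ a).1 (by omega), (hσ (a+1)).1 c1]
            rw [show i - 1 - a = i - 1 - (a+1) + 1 by omega]
            exact (hq.2.2 _ (by omega)).symm
          by_cases c2 : a < i
          · simp only [(hσ a).1 (by omega), (hσ (a+1)).2 c1]
            rw [show i - 1 - a = 0 by omega, show a + 1 = i by omega]
            exact iadj
          · simp only [(hσ a).2 (by omega), (hσ (a+1)).2 c1]
            exact hq.2.2 _ (by omega)
        · simp only [(hσ 0).1 (by omega), Nat.sub_zero]
        · ext v
          simp only [← hqW, Finset.mem_image, Finset.mem_range]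
          constructor
          · rintro ⟨a, ha, rfl⟩
            exact ⟨σ a, Nat.lt_succ_of_le (hσle m (by omega) a (by omega)), rfl⟩
          · rintro ⟨a, ha, rfl⟩
            exact ⟨σ a, Nat.lt_succ_of_le (hσle m (by omega) a (by omega)), by rw [hσσ]⟩
      · intro hmem
        refine htf _ _ _ ((mem_Nb _ _ _ _).1 hmem).2 ?_ iadj
        have := hq.2.2 (i-1) (by omega)
        rwa [Nat.sub_add_cancel i1] at this
    have p0E : p 0 ∈ E := by
      rw [hEdef, Finset.mem_filter]
      exact ⟨Finset.mem_image_of_mem _ (by simp), p, hp, rfl, rfl⟩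
    have hEi := E_indep G S htf d hd hdeg hanti E W hEW hWS (by omega) hN hE
    obtain ⟨hWc, hFi⟩ := F_indep G S htf d hd hdeg hanti E W hEW hWS (by omega) ⟨_, p0E⟩ hN hE
    have alt : ∀ i, i ≤ m → (p i ∈ E ↔ i % 2 = 0) := by
      intro i
      induction i with
      | zero => intro _; simp [p0E]
      | succ i ih =>
        intro hi
        have ih := ih (by omega)
        have ha := hp.2.2 i (by omega)
        have hW1 : p i ∈ W := Finset.mem_image_of_mem _ (Finset.mem_range.2 (by omega))
        have hW2 : p (i+1) ∈ W := Finset.mem_image_of_mem _ (Finset.mem_range.2 (by omega))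
        by_cases h1 : p i ∈ E
        · have : p (i+1) ∉ E := fun h => hEi _ h1 _ h ha
          have h3 := ih.1 h1
          constructor
          · intro h; exact absurd h this
          · intro h; omega
        · have : p (i+1) ∈ E := by
            by_contra h
            exact hFi _ (Finset.mem_sdiff.2 ⟨hW1, h1⟩) _ (Finset.mem_sdiff.2 ⟨hW2, h⟩) ha
          have h3 : ¬ i % 2 = 0 := fun h => h1 (ih.2 h)
          constructor
          · intro _; omega
          · intro _; exact this
    exact hEi _ p0E _ ((alt m le_rfl).2 (by omega)) hpm
  obtain ⟨j, hj1, hj2, hj3⟩ : ∃ j, 2 ≤ j ∧ j + 1 ≤ m ∧ G.Adj (p 0) (p j) := by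
    by_contra hc
    push Not at hc
    have : Nb G S (p 0) ⊆ {p 1, p m} := by
      intro w hw
      obtain ⟨i, hi, rfl⟩ := ext' p hp w hw
      have hadj := ((mem_Nb _ _ _ _).1 hw).2
      have h0 : i ≠ 0 := by
        rintro rfl
        exact G.loopless.irrefl _ hadj
      simp only [Finset.mem_insert, Finset.mem_singleton]
      by_cases h1 : i = 1
      · left; rw [h1]
      · right
        have : i = m := by
          by_contra hne
          exact hc i (by omega) (by omega) hadj
        rw [this]
    have h1 := (Finset.card_le_card this).trans Finset.card_le_two
    have h2 := hdeg _ (hp.1 0 (by omega))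
    omega
  exact ⟨m, j, p, hbig, hres p hp, hpm, hj1, hj2, hj3⟩

end longcycle

theorem connect_path {V : Type*} (G : SimpleGraph V) (S C0 Z : Set V)
    (conn : ∀ T : Set V, (∃ x ∈ S, x ∈ T) → (∃ x ∈ S, x ∉ T) →
      ∃ x ∈ S, ∃ y ∈ S, x ∈ T ∧ y ∉ T ∧ G.Adj x y)
    (hC : ∃ x ∈ S, x ∈ C0) (hZ : ∃ x ∈ S, x ∈ Z) :
    ∃ (n : ℕ) (p : ℕ → V), PS G S n p ∧ p 0 ∈ C0 ∧ p n ∈ Z ∧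
      (∀ a, 1 ≤ a → a ≤ n → p a ∉ C0) ∧ (∀ a, a < n → p a ∉ Z) ∧
      (n ≠ 0 → ∀ x ∈ S, x ∈ C0 → x ∉ Z) := by
  classical
  let Wk : ℕ → (ℕ → V) → Prop := fun n p =>
    (∀ i ≤ n, p i ∈ S) ∧ (∀ i < n, G.Adj (p i) (p (i+1))) ∧ p 0 ∈ C0
  have ex : ∃ n, ∃ p, Wk n p ∧ p n ∈ Z := by
    by_contra hc
    push Not at hc
    obtain ⟨x, hx, hxC⟩ := hC
    obtain ⟨z, hz, hzZ⟩ := hZ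
    obtain ⟨u, hu, v, hv, ⟨n, p, ⟨h1, h2, h3⟩, rfl⟩, hvT, hadj⟩ :=
      conn {v | ∃ n p, Wk n p ∧ p n = v}
      ⟨x, hx, 0, fun _ => x, ⟨fun _ _ => hx, fun i hi => by omega, hxC⟩, rfl⟩
      ⟨z, hz, by rintro ⟨n, p, h, rfl⟩; exact hc n p h hzZ⟩
    apply hvT
    refine ⟨n+1, fun a => if a ≤ n then p a else v, ⟨?_, ?_, ?_⟩, by simp⟩
    · intro i hi
      by_cases c : i ≤ n
      · simp only [c, if_true]; exact h1 i c
      · simp only [c, if_false]; exact hv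
    · intro i hi
      by_cases c : i + 1 ≤ n
      · simp only [c, show i ≤ n by omega, if_true]; exact h2 i (by omega)
      · have e : i = n := by omega
        subst e
        simpa using hadj
    · simpa using h3
  obtain ⟨p, ⟨h1, h2, h3⟩, h4⟩ := Nat.find_spec ex
  have hmin : ∀ n' q, n' < Nat.find ex → Wk n' q → q n' ∉ Z := fun n' q hn hq hz =>
    Nat.find_min ex hn ⟨q, hq, hz⟩
  set n := Nat.find ex with hn
  have inj : ∀ i j, i < j → j ≤ n → p i ≠ p j := by
    intro i j hij hj he
    let q : ℕ → V := fun a => if a ≤ i then p a else p (a + (j - i))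
    have q1 : ∀ a, a ≤ i → q a = p a := fun a ha => by simp [q, ha]
    have q2 : ∀ a, i ≤ a → q a = p (a + (j - i)) := by
      intro a ha
      by_cases e : a = i
      · subst e; rw [q1 a le_rfl, he]; congr 1; omega
      · simp [q, show ¬ a ≤ i by omega]
    apply hmin (n - (j - i)) q (by omega)
    · refine ⟨?_, ?_, ?_⟩
      · intro a ha
        by_cases c : a ≤ i
        · rw [q1 a c]; exact h1 _ (by omega)
        · rw [q2 a (by omega)]; exact h1 _ (by omega)
      · intro a ha
        by_cases c : a < i
        · rw [q1 a (by omega), q1 (a+1) (by omega)]; exact h2 _ (by omega)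
        · rw [q2 a (by omega), q2 (a+1) (by omega), show a + 1 + (j - i) = a + (j - i) + 1 by omega]
          exact h2 _ (by omega)
      · rw [q1 0 (by omega)]; exact h3
    · rw [q2 _ (by omega), show n - (j - i) + (j - i) = n by omega]; exact h4
  refine ⟨n, p, ⟨h1, ?_, h2⟩, h3, h4, ?_, ?_, ?_⟩
  · intro i hi j hj hq
    rcases lt_trichotomy i j with hl | hl | hl
    · exact absurd hq (inj i j hl hj)
    · exact hl
    · exact absurd hq.symm (inj j i hl hi)
  · intro a ha han haC
    apply hmin (n - a) (fun b => p (a + b)) (by omega)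
    · exact ⟨fun i hi => h1 _ (by omega), fun i hi => h2 (a + i) (by omega), haC⟩
    · simpa [show a + (n - a) = n by omega] using h4
  · intro a ha haZ
    exact hmin a p ha ⟨fun i hi => h1 _ (by omega), fun i hi => h2 _ (by omega), h3⟩ haZ
  · intro hn0 x hx hxC hxZ
    exact hmin 0 (fun _ => x) (by omega) ⟨fun _ _ => hx, fun i hi => by omega, hxC⟩ hxZ

set_option maxHeartbeats 1000000 in
theorem core {V : Type*} (G : SimpleGraph V) (S : Finset V) (h : V → V → ℕ)
    (hsymm : ∀ x y, h x y = h y x)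
    (hultra : ∀ x ∈ S, ∀ y ∈ S, ∀ z ∈ S, h x z ≤ max (h x y) (h y z))
    (hself : ∀ x, h x x = 0) (hzero : ∀ x ∈ S, ∀ y ∈ S, h x y = 0 → x = y)
    (hclose : ∀ t p, 1 ≤ t → PS G (S : Set V) t p → HasCycleLength G (t + 2 * h (p 0) (p t)))
    (conn : ∀ T : Set V, (∃ x ∈ S, x ∈ T) → (∃ x ∈ S, x ∉ T) →
      ∃ x ∈ S, ∃ y ∈ S, x ∈ T ∧ y ∉ T ∧ G.Adj x y)
    (h2col : ∀ f : V → Prop, ∃ z ∈ S, ∃ z' ∈ S, G.Adj z z' ∧ (f z ↔ f z'))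
    (m : ℤ) (c : ℤ → V) (hcS : ∀ i, c i ∈ S) (hcinj : ∀ i j, c i = c j ↔ m ∣ i - j)
    (hcadj : ∀ i, G.Adj (c i) (c (i+1))) (hm : 0 < m) (j : ℤ) (hj : 2 ≤ j) (hj' : j ≤ m - 2)
    (hch : G.Adj (c 0) (c j)) (k : ℕ) (hk : (k : ℤ) < m) :
    ∃ ℓ : ℕ, ∀ i < k, HasCycleLength G (ℓ + i) := by
  classical
  obtain ⟨⟨u, v⟩, huv, hmax⟩ := Finset.exists_max_image (S ×ˢ S) (fun x => h x.1 x.2)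
    ⟨(c 0, c 0), Finset.mem_product.2 ⟨hcS 0, hcS 0⟩⟩
  obtain ⟨hu, hv⟩ := Finset.mem_product.1 huv
  simp only at hu hv hmax
  set D := h u v with hD
  have hmax : ∀ x ∈ S, ∀ y ∈ S, h x y ≤ D := fun x hx y hy =>
    hmax (x, y) (Finset.mem_product.2 ⟨hx, hy⟩)
  have hDpos : 0 < D := by
    have h1 : h (c 0) (c 1) ≠ 0 := fun h0 => by
      have := hcadj 0
      rw [zero_add, hzero _ (hcS 0) _ (hcS 1) h0] at this
      exact G.loopless.irrefl _ this
    have := hmax _ (hcS 0) _ (hcS 1)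
    omega
  have hc1 : ∀ i, c i ∈ (S : Set V) := hcS
  by_cases hcase : ∃ x y : ℤ, h (c x) (c y) = D
  · obtain ⟨x, y, hxy⟩ := hcase
    let f : V → Prop := fun z => h z (c x) < D
    have fx : f (c x) := by simp only [f]; rw [hself]; exact hDpos
    have fy : ¬ f (c y) := by simp only [f]; rw [hsymm, hxy]; exact lt_irrefl _
    have hdiff' : ∀ a ∈ S, ∀ b ∈ S, f a → ¬ f b → h a b = D := by
      intro a ha b hb fa fb
      have h1 := hultra b hb a ha (c x) (hcS x)
      have h2 := hmax a ha b hb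
      rw [hsymm b a] at h1
      simp only [f] at fa fb
      rcases max_cases (h a b) (h a (c x)) with h3 | h3 <;> omega
    have hdiff : ∀ a ∈ S, ∀ b ∈ S, ¬ (f a ↔ f b) → h a b = D := by
      intro a ha b hb hab
      by_cases fa : f a
      · exact hdiff' a ha b hb fa (by tauto)
      · rw [hsymm]; exact hdiff' b hb a ha (by tauto) fa
    have fin1 : (∀ t : ℕ, 1 ≤ t → (t : ℤ) < m → ∃ p, PS G S t p ∧ ¬ (f (p 0) ↔ f (p t))) →
        ∃ ℓ : ℕ, ∀ i < k, HasCycleLength G (ℓ + i) := by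
      intro H
      refine ⟨1 + 2 * D, fun i hi => ?_⟩
      obtain ⟨p, hp, hf⟩ := H (i+1) (by omega) (by push_cast; omega)
      have := hclose _ p (by omega) hp
      rw [hdiff _ (hp.1 0 (by omega)) _ (hp.1 _ le_rfl) hf] at this
      convert this using 1; ring
    rcases theta G S m c hc1 hcinj hcadj hm j hj hj' hch f x y fx fy with H | ⟨alt, -⟩
    · exact fin1 H
    obtain ⟨z, hz, z', hz', hzz, hfz⟩ := h2col f
    by_cases hboth : (∃ a, z = c a) ∧ ∃ b, z' = c b
    · obtain ⟨⟨a, rfl⟩, b, rfl⟩ := hboth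
      -- shift
      have e : c b = c (a + (b - a) % m) := by
        rw [hcinj]
        have := Int.dvd_self_sub_emod (x := b - a) (m := m)
        convert this using 1; ring
      have l0 := Int.emod_nonneg (b - a) hm.ne'
      have l1 := Int.emod_lt_of_pos (b - a) hm
      set J := (b - a) % m with hJ
      rw [e] at hzz hfz
      have J0 : J ≠ 0 := by
        intro h0; rw [h0, add_zero] at hzz; exact G.loopless.irrefl _ hzz
      have J1 : J ≠ 1 := by
        intro h0; rw [h0] at hfz; have := alt a; tauto
      have J2 : J ≠ m - 1 := by
        intro h0; rw [h0] at hfz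
        have h1 := alt (a + (m - 1))
        have h2 : c (a + (m - 1) + 1) = c a := by rw [hcinj]; exact ⟨1, by ring⟩
        rw [h2] at h1
        tauto
      rcases theta G S m (fun i => c (a + i)) (fun i => hc1 _)
        (fun i j => by rw [hcinj]; simp)
        (fun i => by rw [← add_assoc]; exact hcadj _) hm J (by omega) (by omega)
        (by simpa using hzz) f (x - a) (y - a) (by simpa using fx) (by simpa using fy) with H | ⟨-, H⟩
      · exact fin1 H
      · simp only [add_zero] at H
        exact absurd hfz H
    · obtain ⟨n, p, hp, ⟨i0, hi0⟩, hpZ, hout, hpre, hn00⟩ := connect_path G S (Set.range c) {z, z'} conn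
        ⟨c 0, hcS 0, 0, rfl⟩ ⟨z, hz, by simp⟩
      -- rename so that the path ends at w, other end w'
      obtain ⟨w, w', hw', hww, hfw, hpw, hb, hw'Z, hpre'⟩ : ∃ w w', w' ∈ S ∧ G.Adj w w' ∧ (f w ↔ f w') ∧
          p n = w ∧ ¬ ((∃ a, w = c a) ∧ ∃ b, w' = c b) ∧
          w' ∈ ({z, z'} : Set V) ∧ ∀ a, a < n → p a ≠ w' ∧ p a ≠ w := by
        rcases hpZ with e | e
        · refine ⟨z, z', hz', hzz, hfz, e, hboth, by simp, fun a ha => ?_⟩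
          have := hpre a ha
          simp only [Set.mem_insert_iff, Set.mem_singleton_iff, not_or] at this
          exact ⟨this.2, this.1⟩
        · refine ⟨z', z, hz, hzz.symm, hfz.symm, e, fun h => hboth ⟨h.2, h.1⟩, by simp, fun a ha => ?_⟩
          have := hpre a ha
          simp only [Set.mem_insert_iff, Set.mem_singleton_iff, not_or] at this
          exact this
      have hwC : ∀ b, w' ≠ c b := by
        intro b hb'
        apply hb
        refine ⟨?_, b, hb'⟩
        rcases Nat.eq_zero_or_pos n with h0 | h0
        · subst h0; exact ⟨i0, by rw [← hpw, hi0]⟩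
        · exfalso
          exact hn00 h0.ne' w' hw' ⟨b, hb'.symm⟩ hw'Z
      have hout' : ∀ a, 1 ≤ a → a ≤ n → ∀ i, p a ≠ c i := fun a h1 h2 i e =>
        hout a h1 h2 ⟨i, e.symm⟩
      -- the two families of paths
      have fam1 : ∀ s : ℕ, (s:ℤ) < m → 1 ≤ n + s → ¬ (f w ↔ f (c (i0 + s))) →
          HasCycleLength G (n + s + 2 * D) := by
        intro s hs hns hf
        obtain ⟨q, hq, q0, qe⟩ := lolli G S m c hc1 hcinj hcadj n p i0 hi0.symm hp hout' s hs
        have := hclose _ q hns hq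
        rw [hdiff _ (hq.1 0 (by omega)) _ (hq.1 _ le_rfl) (by rw [q0, qe, hpw]; exact hf)] at this
        exact this
      let p' : ℕ → V := fun a => if a ≤ n then p a else w'
      have p'1 : ∀ a, a ≤ n → p' a = p a := fun a ha => by simp [p', ha]
      have p'2 : p' (n+1) = w' := by simp [p']
      have hpne : ∀ a, a ≤ n → p a ≠ w' := by
        intro a ha e
        rcases Nat.lt_or_ge a n with h1 | h1
        · exact (hpre' a h1).1 e
        · have : a = n := by omega
          rw [this, hpw] at e
          rw [e] at hww
          exact G.loopless.irrefl _ hww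
      have hp' : PS G (S : Set V) (n+1) p' := by
        refine ⟨?_, ?_, ?_⟩
        · intro a ha
          by_cases ca : a ≤ n
          · rw [p'1 a ca]; exact hp.1 a ca
          · rw [show a = n + 1 by omega, p'2]; exact hw'
        · intro a ha b hb hab
          by_cases ca : a ≤ n
          · by_cases cb : b ≤ n
            · rw [p'1 a ca, p'1 b cb] at hab; exact hp.2.1 a ca b cb hab
            · rw [p'1 a ca, show b = n + 1 by omega, p'2] at hab
              exact absurd hab (hpne a ca)
          · by_cases cb : b ≤ n
            · rw [p'1 b cb, show a = n + 1 by omega, p'2] at hab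
              exact absurd hab.symm (hpne b cb)
            · omega
        · intro a ha
          by_cases ca : a + 1 ≤ n
          · rw [p'1 a (by omega), p'1 _ ca]; exact hp.2.2 a (by omega)
          · have e : a = n := by omega
            rw [e, p'1 n le_rfl, p'2, hpw]; exact hww
      have fam2 : ∀ s : ℕ, (s:ℤ) < m → ¬ (f w ↔ f (c (i0 + s))) →
          HasCycleLength G (n + 1 + s + 2 * D) := by
        intro s hs hf
        obtain ⟨q, hq, q0, qe⟩ := lolli G S m c hc1 hcinj hcadj (n+1) p' i0
          (by rw [p'1 0 (by omega)]; exact hi0.symm) hp' (by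
            intro a h1 h2 i
            by_cases ca : a ≤ n
            · rw [p'1 a ca]; exact hout' a h1 ca i
            · rw [show a = n + 1 by omega, p'2]; exact hwC i) s hs
        have := hclose _ q (by omega) hq
        rw [hdiff _ (hq.1 0 (by omega)) _ (hq.1 _ le_rfl) (by rw [q0, qe, p'2, ← hfw]; exact hf)]
          at this
        exact this
      have altn : ∀ s : ℕ, (f (c (i0 + s)) ↔ f (c i0)) ↔ s % 2 = 0 := by
        intro s
        induction s with
        | zero => simp
        | succ s ih =>
          have := alt (i0 + s)
          rw [add_assoc] at this
          push_cast
          have h3 : (s+1) % 2 = 0 ↔ ¬ s % 2 = 0 := by omega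
          rw [h3, this, ← ih, not_iff]
      have alt1 : ∀ s : ℕ, s % 2 = 1 → (f w ↔ f (c i0)) → ¬ (f w ↔ f (c (i0 + s))) := by
        intro s hs h1 h2
        have := (altn s).1 (h2.symm.trans h1)
        omega
      have alt0 : ∀ s : ℕ, s % 2 = 0 → ¬ (f w ↔ f (c i0)) → ¬ (f w ↔ f (c (i0 + s))) := by
        intro s hs h1 h2
        exact h1 (h2.trans ((altn s).2 hs))
      by_cases hfa : f w ↔ f (c i0)
      · refine ⟨n + 1 + 2 * D, fun i hi => ?_⟩
        rcases Nat.mod_two_eq_zero_or_one i with h | h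
        · have := fam1 (i+1) (by push_cast; omega) (by omega) (alt1 _ (by omega) hfa)
          convert this using 1; ring
        · have := fam2 i (by omega) (alt1 _ h hfa)
          convert this using 1; ring
      · have hn0 : n ≠ 0 := by
          rintro rfl
          apply hfa
          rw [← hpw, hi0]
        refine ⟨n + 2 * D, fun i hi => ?_⟩
        rcases Nat.mod_two_eq_zero_or_one i with h | h
        · have := fam1 i (by omega) (by omega) (alt0 _ h hfa)
          convert this using 1; ring
        · have := fam2 (i-1) (by omega) (alt0 _ (by omega) hfa)
          convert this using 1; omega
  · push Not at hcase
    have hlt : ∀ a b, h (c a) (c b) < D := fun a b =>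
      lt_of_le_of_ne (hmax _ (hcS a) _ (hcS b)) (hcase a b)
    obtain ⟨o, ho, ho0⟩ : ∃ o ∈ S, h o (c 0) = D := by
      by_contra hcc
      push Not at hcc
      have h1 := lt_of_le_of_ne (hmax u hu _ (hcS 0)) (hcc u hu)
      have h2 := lt_of_le_of_ne (hmax v hv _ (hcS 0)) (hcc v hv)
      have h3 := hultra u hu (c 0) (hcS 0) v hv
      rw [hsymm (c 0) v] at h3
      rcases max_cases (h u (c 0)) (h v (c 0)) with h4 | h4 <;> omega
    have hoD : ∀ a, h o (c a) = D := by
      intro a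
      have h1 := hultra o ho (c a) (hcS a) (c 0) (hcS 0)
      have h2 := hlt a 0
      have h3 := hmax o ho _ (hcS a)
      rcases max_cases (h o (c a)) (h (c a) (c 0)) with h4 | h4 <;> omega
    obtain ⟨n, p, hp, ⟨i0, hi0⟩, hpZ, hout, hpre, hn00⟩ := connect_path G S (Set.range c) {o} conn
        ⟨c 0, hcS 0, 0, rfl⟩ ⟨o, ho, by simp⟩
    have hpo : p n = o := hpZ
    have hn0 : n ≠ 0 := by
      rintro rfl
      have := hlt i0 0
      rw [hi0, hpo, hoD] at this
      exact lt_irrefl _ this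
    refine ⟨n + 2 * D, fun i hi => ?_⟩
    obtain ⟨q, hq, q0, qe⟩ := lolli G S m c hc1 hcinj hcadj n p i0 hi0.symm hp
      (fun a h1 h2 i e => hout a h1 h2 ⟨i, e.symm⟩) i (by omega)
    have := hclose _ q (by omega) hq
    rw [q0, qe, hpo, hoD] at this
    convert this using 1; ring

/-- `T` spans a `d`-colourable subgraph. -/
def Col {V : Type*} (G : SimpleGraph V) (d : ℕ) (T : Finset V) : Prop :=
  ∃ f : V → Fin d, ∀ u ∈ T, ∀ v ∈ T, G.Adj u v → f u ≠ f v

theorem exists_level {V : Type*} [Fintype V] (G : SimpleGraph V) (d : ℕ)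
    (h : ¬ G.Colorable (2 * d)) :
    ∃ (r : V) (L : ℕ) (T : Finset V), (∀ v, v ∈ T ↔ G.Reachable r v ∧ G.dist r v = L) ∧
      ¬ Col G d T := by
  classical
  by_contra hc
  push Not at hc
  apply h
  have hcol : ∀ (r : V) (L : ℕ), ∃ f : V → Fin d, ∀ u v, G.Reachable r u → G.dist r u = L →
      G.Reachable r v → G.dist r v = L → G.Adj u v → f u ≠ f v := by
    intro r L
    obtain ⟨f, hf⟩ := hc r L (Finset.univ.filter (fun v => G.Reachable r v ∧ G.dist r v = L))
      (by simp)
    exact ⟨f, fun u v h1 h2 h3 h4 => hf u (by simp [h1, h2]) v (by simp [h3, h4])⟩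
  choose F hF using hcol
  let rt : V → V := fun v => (G.connectedComponentMk v).out
  have hrt : ∀ v, G.Reachable (rt v) v := fun v => by
    rw [← SimpleGraph.ConnectedComponent.eq]
    exact Quot.out_eq _
  have hdist : ∀ r u v, G.Reachable r u → G.Adj u v → G.dist r v ≤ G.dist r u + 1 := by
    intro r u v hr ha
    obtain ⟨w, hw⟩ := hr.exists_walk_length_eq_dist
    have := SimpleGraph.dist_le (w.concat ha)
    rw [SimpleGraph.Walk.length_concat, hw] at this
    exact this
  have C : G.Coloring (Fin 2 × Fin d) := SimpleGraph.Coloring.mk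
    (fun v => (⟨G.dist (rt v) v % 2, Nat.mod_lt _ (by norm_num)⟩, F (rt v) (G.dist (rt v) v) v)) (by
      intro u v ha he
      have hruv : rt u = rt v := by
        simp only [rt]
        rw [SimpleGraph.ConnectedComponent.eq.2 ha.reachable]
      rw [← hruv] at he
      have hv : G.Reachable (rt u) v := hruv ▸ hrt v
      have h1 := hdist _ u v (hrt u) ha
      have h2 := hdist _ v u hv ha.symm
      simp only [Prod.mk.injEq, Fin.mk.injEq] at he
      have h3 : G.dist (rt u) v = G.dist (rt u) u := by omega
      rw [h3] at he
      exact hF _ _ u v (hrt u) rfl hv h3 ha he.2)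
  have := C.colorable
  simpa using this

theorem exists_critical {V : Type*} (G : SimpleGraph V) (d : ℕ)
    (T : Finset V) (hT : ¬ Col G d T) :
    ∃ S ⊆ T, ¬ Col G d S ∧ ∀ S' ⊂ S, Col G d S' := by
  induction T using Finset.strongInduction with
  | H T ih =>
    by_cases h : ∀ S' ⊂ T, Col G d S'
    · exact ⟨T, subset_rfl, hT, h⟩
    · push Not at h
      obtain ⟨S', h1, h2⟩ := h
      obtain ⟨S, h3, h4⟩ := ih S' h1 h2
      exact ⟨S, h3.trans h1.subset, h4⟩

section crit
variable {V : Type*} (G : SimpleGraph V) (d : ℕ) (S : Finset V)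
  (hS : ¬ Col G d S) (hmin : ∀ S' ⊂ S, Col G d S')
include hS hmin

theorem crit_deg : ∀ v ∈ S, d ≤ (Nb G S v).card := by
  classical
  intro v hv
  by_contra hc
  obtain ⟨f, hf⟩ := hmin _ (Finset.erase_ssubset hv)
  have h1 : ((Nb G S v).image f).card < (Finset.univ : Finset (Fin d)).card := by
    have := Finset.card_image_le (s := Nb G S v) (f := f)
    simp only [Finset.card_univ, Fintype.card_fin]
    omega
  obtain ⟨a, -, ha⟩ := Finset.exists_mem_notMem_of_card_lt_card h1
  have ha' : ∀ w ∈ S, G.Adj v w → f w ≠ a := fun w hw h e =>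
    ha (Finset.mem_image.2 ⟨w, (mem_Nb _ _ _ _).2 ⟨hw, h⟩, e⟩)
  apply hS
  refine ⟨Function.update f v a, fun u hu w hw h => ?_⟩
  by_cases hu' : u = v
  · subst hu'
    rw [Function.update_self, Function.update_of_ne h.ne']
    exact (ha' w hw h).symm
  · rw [Function.update_of_ne hu']
    by_cases hw' : w = v
    · subst hw'
      rw [Function.update_self]
      exact ha' u hu h.symm
    · rw [Function.update_of_ne hw']
      exact hf u (Finset.mem_erase.2 ⟨hu', hu⟩) w (Finset.mem_erase.2 ⟨hw', hw⟩) h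

theorem crit_anti : ∀ u ∈ S, ∀ v ∈ S, u ≠ v → ¬ Nb G S u ⊆ Nb G S v := by
  classical
  intro v hv x hx hvx hsub
  obtain ⟨f, hf⟩ := hmin _ (Finset.erase_ssubset hv)
  have ha' : ∀ w ∈ S, G.Adj v w → f w ≠ f x := fun w hw h => by
    have := ((mem_Nb _ _ _ _).1 (hsub ((mem_Nb _ _ _ _).2 ⟨hw, h⟩))).2
    exact (hf x (Finset.mem_erase.2 ⟨hvx.symm, hx⟩) w (Finset.mem_erase.2 ⟨h.ne', hw⟩) this).symm
  apply hS
  refine ⟨Function.update f v (f x), fun u hu w hw h => ?_⟩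
  by_cases hu' : u = v
  · subst hu'
    rw [Function.update_self, Function.update_of_ne h.ne']
    exact (ha' w hw h).symm
  · rw [Function.update_of_ne hu']
    by_cases hw' : w = v
    · subst hw'
      rw [Function.update_self]
      exact ha' u hu h.symm
    · rw [Function.update_of_ne hw']
      exact hf u (Finset.mem_erase.2 ⟨hu', hu⟩) w (Finset.mem_erase.2 ⟨hw', hw⟩) h

theorem crit_conn (T : Set V) (h1 : ∃ x ∈ S, x ∈ T) (h2 : ∃ x ∈ S, x ∉ T) :
    ∃ x ∈ S, ∃ y ∈ S, x ∈ T ∧ y ∉ T ∧ G.Adj x y := by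
  classical
  by_contra hc
  push Not at hc
  obtain ⟨x, hx, hxT⟩ := h1
  obtain ⟨y, hy, hyT⟩ := h2
  obtain ⟨f, hf⟩ := hmin (S.filter (· ∈ T)) (Finset.filter_ssubset.2 ⟨y, hy, hyT⟩)
  obtain ⟨g, hg⟩ := hmin (S.filter (· ∉ T)) (Finset.filter_ssubset.2 ⟨x, hx, by simpa using hxT⟩)
  apply hS
  refine ⟨fun v => if v ∈ T then f v else g v, fun u hu v hv h => ?_⟩
  by_cases a : u ∈ T
  · by_cases b : v ∈ T
    · simp only [a, b, if_true]
      exact hf u (by simp [hu, a]) v (by simp [hv, b]) h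
    · exact absurd h (hc u hu v hv a b)
  · by_cases b : v ∈ T
    · exact absurd h.symm (hc v hv u hu b a)
    · simp only [a, b, if_false]
      exact hg u (by simp [hu, a]) v (by simp [hv, b]) h

omit hmin in
theorem crit_nonbip (hd : 2 ≤ d) (f : V → Prop) :
    ∃ z ∈ S, ∃ z' ∈ S, G.Adj z z' ∧ (f z ↔ f z') := by
  classical
  by_contra hc
  push Not at hc
  apply hS
  refine ⟨fun v => if f v then ⟨0, by omega⟩ else ⟨1, by omega⟩, fun u hu v hv h => ?_⟩
  have := hc u hu v hv h
  by_cases a : f u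
  · by_cases b : f v
    · tauto
    · simp [a, b]
  · by_cases b : f v
    · simp [a, b]
    · tauto

end crit

/-- For `k ≥ 6`, every triangle-free graph of chromatic number `k + 1` contains `k` cycles of
consecutive lengths. -/
theorem stmt_10 {V : Type*} [Fintype V] (k : ℕ) (hk : 6 ≤ k)
    (G : SimpleGraph V) (htf : G.CliqueFree 3) (hchrom : G.chromaticNumber = k + 1) :
    ∃ ℓ : ℕ, ∀ i < k, HasCycleLength G (ℓ + i) := by
  classical
  have htf' : ∀ a b c, G.Adj a b → G.Adj b c → G.Adj a c → False := fun a b c h1 h2 h3 =>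
    htf {a, b, c} (SimpleGraph.is3Clique_triple_iff.2 ⟨h1, h3, h2⟩)
  obtain ⟨d, hd⟩ : ∃ d, d = k / 2 := ⟨_, rfl⟩
  have hnc : ¬ G.Colorable (2 * d) := by
    intro h
    have h1 := h.chromaticNumber_le
    rw [hchrom] at h1
    have h2 : k + 1 ≤ 2 * d := by exact_mod_cast h1
    omega
  obtain ⟨r, L, T, hT, hTc⟩ := exists_level G d hnc
  obtain ⟨S, hST, hSc, hSmin⟩ := exists_critical G d T hTc
  have hne : S.Nonempty := by
    obtain ⟨z, hz, -⟩ := crit_nonbip G d S hSc (by omega) (fun _ => True)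
    exact ⟨z, hz⟩
  obtain ⟨m, j, p, hm, hp, hpm, hj1, hj2, hj3⟩ := longcycle G S htf' d (by omega)
    (crit_deg G d S hSc hSmin) (crit_anti G d S hSc hSmin) hne
  -- parents
  have hpar : ∀ v, ∃ u, G.Reachable r v → G.dist r v ≠ 0 →
      G.Reachable r u ∧ G.Adj v u ∧ G.dist r u + 1 = G.dist r v := by
    intro v
    by_cases hv : G.Reachable r v ∧ G.dist r v ≠ 0
    · obtain ⟨w, hw⟩ := hv.1.symm.exists_walk_length_eq_dist
      rw [SimpleGraph.dist_comm] at hw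
      cases w with
      | nil => simp at hv
      | cons h q =>
        rename_i u
        refine ⟨u, fun _ _ => ⟨q.reachable.symm, h, ?_⟩⟩
        have h1 := SimpleGraph.dist_le q.reverse
        rw [SimpleGraph.Walk.length_reverse] at h1
        rw [SimpleGraph.Walk.length_cons] at hw
        obtain ⟨w', hw'⟩ := q.reachable.symm.exists_walk_length_eq_dist
        have h2 := SimpleGraph.dist_le (w'.concat h.symm)
        rw [SimpleGraph.Walk.length_concat] at h2
        omega
    · exact ⟨v, fun h1 h2 => absurd ⟨h1, h2⟩ hv⟩
  choose π hπ using hpar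
  have hr : ∀ v, G.Reachable r v → G.dist r v = 0 → v = r := fun v h1 h2 =>
    (h1.dist_eq_zero_iff.1 h2).symm
  have hSg : ∀ v ∈ (S : Set V), G.Reachable r v ∧ G.dist r v = L := fun v hv =>
    (hT v).1 (hST hv)
  have hM : (0 : ℤ) < (m : ℤ) + 1 := by omega
  have e0 := fun i : ℤ => Int.emod_nonneg i hM.ne'
  have e1 := fun i : ℤ => Int.emod_lt_of_pos i hM
  have small : ∀ a : ℕ, a ≤ m → ((a : ℤ) % ((m : ℤ) + 1)).toNat = a := by
    intro a ha
    rw [Int.emod_eq_of_lt (by omega) (by omega)]; simp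
  refine core G S (hgt π) (hgt_symm π) ?_ ?_ ?_ ?_ (crit_conn G d S hSc hSmin)
    (crit_nonbip G d S hSc (by omega)) ((m : ℤ) + 1) (fun i => p (i % ((m : ℤ) + 1)).toNat)
    ?_ ?_ ?_ hM (j : ℤ) (by omega) (by omega) ?_ k (by omega)
  · intro x hx y hy z hz
    exact hgt_ultra G π (G.dist r) (G.Reachable r) r hπ hr (hSg x hx).1 (hSg x hx).2
      (hSg y hy).1 (hSg y hy).2 (hSg z hz).1 (hSg z hz).2
  · intro x
    exact Nat.sInf_eq_zero.2 (Or.inl rfl)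
  · intro x hx y hy h
    have := (hgt_spec G π (G.dist r) (G.Reachable r) r hπ hr (hSg x hx).1 (hSg x hx).2
      (hSg y hy).1 (hSg y hy).2).1
    rw [h] at this
    exact this
  · intro t q ht hq
    exact cycle_close G π (G.dist r) (G.Reachable r) r hπ hr hSg ht hq
  · intro i
    have := e0 i
    have := e1 i
    exact hp.1 _ (by omega)
  · intro a b
    have a0 := e0 a
    have a1 := e1 a
    have b0 := e0 b
    have b1 := e1 b
    rw [Int.dvd_iff_emod_eq_zero, ← Int.emod_eq_emod_iff_emod_sub_eq_zero]
    constructor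
    · intro h
      have := hp.2.1 _ (by omega) _ (by omega) h
      omega
    · intro h
      simp only [h]
  · intro i
    have i0 := e0 i
    have i1 := e1 i
    have hadd : (i + 1) % ((m : ℤ) + 1) = (i % ((m : ℤ) + 1) + 1) % ((m : ℤ) + 1) := by
      rw [Int.emod_add_emod]
    simp only [hadd]
    by_cases hl : i % ((m : ℤ) + 1) = m
    · rw [hl]
      simp only [Int.emod_self, Int.toNat_natCast, Int.toNat_zero]
      exact hpm.symm
    · rw [Int.emod_eq_of_lt (by omega) (by omega : i % ((m : ℤ) + 1) + 1 < (m : ℤ) + 1),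
        show (i % ((m : ℤ) + 1) + 1).toNat = (i % ((m : ℤ) + 1)).toNat + 1 by omega]
      exact hp.2.2 _ (by omega)
  · have h0 := small 0 (by omega)
    simp only [small j (by omega)]
    simpa using hj3
end

section
/- Let k ≥ 3 be an integer and let G be a 2-connected finite simple graph of minimum degree at least k. If G is K_3-free, then G contains a cycle of length at least 2k+2, unless G is isomorphic to the complete bipartite graph K_{k,n} for some n ≥ k. -/
/-- A finite graph is 2-connected: it has at least 3 vertices and remains connected after
deleting any single vertex. -/
def TwoConnected {V : Type*} [Fintype V] (G : SimpleGraph V) : Prop :=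
  3 ≤ Fintype.card V ∧ ∀ v : V, (G.induce ({v}ᶜ : Set V)).Connected

def PathL {V : Type*} (G : SimpleGraph V) (a b : V) (l : List V) : Prop :=
  l.IsChain G.Adj ∧ l.Nodup ∧ l.head? = some a ∧ l.getLast? = some b

theorem PathL.single {V : Type*} (G : SimpleGraph V) (a : V) : PathL G a a [a] := by
  simp [PathL]

theorem PathL.append {V : Type*} {G : SimpleGraph V} {a b c d : V} {l m : List V}
    (h1 : PathL G a b l) (h2 : PathL G c d m) (h : G.Adj b c) (hd : ∀ x ∈ l, x ∉ m) :
    PathL G a d (l ++ m) := by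
  obtain ⟨c1, n1, s1, e1⟩ := h1
  obtain ⟨c2, n2, s2, e2⟩ := h2
  refine ⟨?_, ?_, ?_, ?_⟩
  · rw [List.isChain_append]
    refine ⟨c1, c2, ?_⟩
    rw [e1, s2]; simp [h]
  · rw [List.nodup_append]
    exact ⟨n1, n2, fun x hx y hy hxy => hd x hx (hxy ▸ hy)⟩
  · simp [List.head?_append, s1]
  · simp [List.getLast?_append, e2]

theorem PathL.reverse {V : Type*} {G : SimpleGraph V} {a b : V} {l : List V}
    (h1 : PathL G a b l) : PathL G b a l.reverse := by
  obtain ⟨c1, n1, s1, e1⟩ := h1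
  refine ⟨?_, ?_, ?_, ?_⟩
  · rw [List.isChain_reverse]
    exact c1.imp (fun _ _ h => h.symm)
  · simpa using n1
  · simpa using e1
  · simpa using s1

theorem PathL.mem_left {V : Type*} {G : SimpleGraph V} {a b : V} {l : List V}
    (h1 : PathL G a b l) : a ∈ l := List.mem_of_mem_head? h1.2.2.1

theorem PathL.mem_right {V : Type*} {G : SimpleGraph V} {a b : V} {l : List V}
    (h1 : PathL G a b l) : b ∈ l := List.mem_of_mem_getLast? h1.2.2.2

theorem PathL.cons {V : Type*} {G : SimpleGraph V} {a b c : V} {l : List V}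
    (h1 : PathL G a b l) (h : G.Adj c a) (hc : c ∉ l) : PathL G c b (c :: l) := by
  have := (PathL.single G c).append h1 h (by simpa using hc)
  simpa using this

theorem PathL.suffix {V : Type*} {G : SimpleGraph V} {a b v : V} {l : List V}
    (h1 : PathL G a b l) (hv : v ∈ l) (hva : v ≠ a) :
    ∃ l', PathL G v b l' ∧ (∀ x ∈ l', x ∈ l) ∧ a ∉ l' ∧ l'.length < l.length := by
  obtain ⟨s, t, rfl⟩ := List.append_of_mem hv
  obtain ⟨c1, n1, s1, e1⟩ := h1
  cases s with
  | nil => simp at s1; exact absurd s1 hva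
  | cons y s =>
    simp at s1
    subst s1
    refine ⟨v :: t, ⟨?_, ?_, ?_, ?_⟩, ?_, ?_, ?_⟩
    · exact (List.isChain_append.1 c1).2.1
    · exact (List.nodup_append.1 n1).2.1
    · simp
    · simpa [List.getLast?_append, List.getLast?_cons] using e1
    · intro x hx; simp at hx ⊢; tauto
    · simp at n1 ⊢; tauto
    · simp

theorem PathL.toWalk {V : Type*} {G : SimpleGraph V} {b : V} (l : List V) :
    ∀ a, PathL G a b l → ∃ p : G.Walk a b, p.support = l := by
  induction l with
  | nil => intro a h; simp [PathL] at h
  | cons x l ih =>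
    intro a h
    obtain ⟨c1, n1, s1, e1⟩ := h
    simp at s1; subst s1
    cases l with
    | nil => simp at e1; subst e1; exact ⟨.nil, by simp⟩
    | cons y l =>
      obtain ⟨p, hp⟩ := ih y ⟨(List.isChain_cons_cons.1 c1).2, (List.nodup_cons.1 n1).2, by simp,
        by simpa [List.getLast?_cons_cons] using e1⟩
      exact ⟨.cons (List.isChain_cons_cons.1 c1).1 p, by simp [hp]⟩

theorem PathL.hasCycle {V : Type*} {G : SimpleGraph V} {a b : V} {l : List V}
    (h : PathL G a b l) (hab : G.Adj b a) (hl : 3 ≤ l.length) : HasCycleLength G l.length := by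
  obtain ⟨p, hp⟩ := PathL.toWalk l a h
  have hpath : p.IsPath := by rw [SimpleGraph.Walk.isPath_def, hp]; exact h.2.1
  have hlen : p.length + 1 = l.length := by rw [← hp, SimpleGraph.Walk.length_support]
  refine ⟨b, .cons hab p, ?_, by simpa using hlen⟩
  rw [SimpleGraph.Walk.cons_isCycle_iff]
  refine ⟨hpath, fun hmem => ?_⟩
  cases p with
  | nil => simp at hmem
  | cons h' q =>
    rw [SimpleGraph.Walk.cons_isPath_iff] at hpath
    simp at hmem
    rcases hmem with h1 | h1
    · rcases h1 with ⟨h1, h2⟩ | h1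
      · exact hab.ne h1
      · subst h1
        have := hpath.1
        rw [SimpleGraph.Walk.isPath_iff_nil, ← SimpleGraph.Walk.eq_nil_iff_nil] at this
        subst this
        simp at hlen; omega
    · exact hpath.2 (SimpleGraph.Walk.snd_mem_support_of_mem_edges _ h1)

/-- hitting lemma -/
theorem hit_lemma {V : Type*} [Fintype V] {G : SimpleGraph V} (h2 : TwoConnected G)
    (x z : V) (hxz : z ≠ x) (T : Set V) (t0 : V) (ht0 : t0 ∈ T) (ht0x : t0 ≠ x) (hz : z ∉ T) :
    ∃ r e t, PathL G z e r ∧ (∀ v ∈ r, v ∉ T) ∧ x ∉ r ∧ G.Adj e t ∧ t ∈ T ∧ t ≠ x := by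
  obtain ⟨w⟩ := (h2.2 x).preconnected ⟨z, hxz⟩ ⟨t0, ht0x⟩
  have key : ∀ (a b : ({x}ᶜ : Set V)) (w : (G.induce ({x}ᶜ : Set V)).Walk a b), (b : V) ∈ T →
      (a : V) ∉ T →
      ∃ r e t, PathL G a e r ∧ (∀ v ∈ r, v ∉ T) ∧ x ∉ r ∧ G.Adj e t ∧ t ∈ T ∧ t ≠ x := by
    intro a b w
    induction w with
    | nil => intro h h'; exact absurd h h'
    | @cons u v w hadj p ih =>
      intro hb ha
      have hadj' : G.Adj u v := by simpa using hadj
      by_cases hv : (v : V) ∈ T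
      · refine ⟨[(u : V)], u, v, PathL.single G _, ?_, ?_, hadj', hv, v.2⟩
        · simpa using ha
        · simpa using fun h => u.2 h.symm
      · obtain ⟨r, e, t, hr, h1, h3, h4, h5, h6⟩ := ih hb hv
        by_cases hu : (u : V) ∈ r
        · by_cases huv : (u : V) = v
          · exact absurd huv hadj'.ne
          · obtain ⟨r', hr', hs, _⟩ := hr.suffix hu huv
            exact ⟨r', e, t, hr', fun y hy => h1 y (hs y hy), fun h => h3 (hs _ h), h4, h5, h6⟩
        · refine ⟨u :: r, e, t, hr.cons hadj' hu, ?_, ?_, h4, h5, h6⟩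
          · intro y hy
            rcases List.mem_cons.1 hy with rfl | hy
            · exact ha
            · exact h1 y hy
          · intro hy
            rcases List.mem_cons.1 hy with hy | hy
            · exact u.2 hy.symm
            · exact h3 hy
  exact key _ _ w ht0 hz

/-- two disjoint paths from `x` and `z` to `C` -/
def TwoPth {V : Type*} (G : SimpleGraph V) (C : Set V) (x z : V) (n : ℕ) : Prop :=
  ∃ p q u w l m, PathL G x p l ∧ PathL G z q m ∧ G.Adj p u ∧ G.Adj q w ∧ u ∈ C ∧ w ∈ C ∧ u ≠ w ∧
    (∀ v ∈ l, v ∉ C) ∧ (∀ v ∈ m, v ∉ C) ∧ (∀ v ∈ l, v ∉ m) ∧ l.length + m.length = n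

def Fan {V : Type*} (G : SimpleGraph V) (C : Set V) (x : V) (p q u w : V) (l m : List V) : Prop :=
  PathL G x p l ∧ PathL G x q m ∧ G.Adj p u ∧ G.Adj q w ∧ u ∈ C ∧ w ∈ C ∧ u ≠ w ∧
    (∀ v ∈ l, v ∉ C) ∧ (∀ v ∈ m, v ∉ C) ∧ (∀ v ∈ l, v ∈ m → v = x)

theorem Fan.symm {V : Type*} {G : SimpleGraph V} {C : Set V} {x p q u w : V} {l m : List V}
    (h : Fan G C x p q u w l m) : Fan G C x q p w u m l := by
  obtain ⟨h1, h2, h3, h4, h5, h6, h7, h8, h9, h10⟩ := h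
  exact ⟨h2, h1, h4, h3, h6, h5, h7.symm, h9, h8, fun v a b => h10 v b a⟩

theorem aug_lemma {V : Type*} [Fintype V] {G : SimpleGraph V} (h2 : TwoConnected G)
    {C : Set V} {x p q u w : V} {l m : List V} (hf : Fan G C x p q u w l m) (hx : x ∉ C)
    (z : V) (hz : z ∉ C) (hzx : z ≠ x) : ∃ n, TwoPth G C x z n := by
  have inl : ∀ {p q u w : V} {l m : List V}, Fan G C x p q u w l m → z ∈ l → 
      ∃ n, TwoPth G C x z n := by
    intro p q u w l m hf hzl
    obtain ⟨g1, g2, g3, g4, g5, g6, g7, g8, g9, g10⟩ := hf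
    obtain ⟨l', k1, k2, k3, _⟩ := g1.suffix hzl hzx
    exact ⟨_, q, p, w, u, m, l', g2, k1, g4, g3, g6, g5, g7.symm, g9, fun v hv => g8 v (k2 v hv),
      fun v hv hv' => k3 (g10 v (k2 v hv') hv ▸ hv'), rfl⟩
  by_cases hzl : z ∈ l
  · exact inl hf hzl
  by_cases hzm : z ∈ m
  · exact inl hf.symm hzm
  obtain ⟨r, e, t, hr, h1, h3, h4, h5, h6⟩ := hit_lemma h2 x z hzx (C ∪ {v | v ∈ l} ∪ {v | v ∈ m})
    u (by simp [hf.2.2.2.2.1]) (fun h => hx (h ▸ hf.2.2.2.2.1)) (by simp [hz, hzl, hzm])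
  have hrC : ∀ v ∈ r, v ∉ C := fun v hv => by have := h1 v hv; simp at this; tauto
  have hrl : ∀ v ∈ r, v ∉ l := fun v hv => by have := h1 v hv; simp at this; tauto
  have hrm : ∀ v ∈ r, v ∉ m := fun v hv => by have := h1 v hv; simp at this; tauto
  have inC : ∀ {p q u w : V} {l m : List V}, Fan G C x p q u w l m → (∀ v ∈ r, v ∉ l) → t ∈ C → 
     t ≠ u → ∃ n, TwoPth G C x z n := by
    intro p q u w l m hf hrl htC htu
    obtain ⟨g1, g2, g3, g4, g5, g6, g7, g8, g9, g10⟩ := hf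
    exact ⟨_, p, e, u, t, l, r, g1, hr, g3, h4, g5, htC, htu.symm, g8, hrC, fun v a b => hrl v b a, rfl⟩
  have inl2 : ∀ {p q u w : V} {l m : List V}, Fan G C x p q u w l m → (∀ v ∈ r, v ∉ l) →
      (∀ v ∈ r, v ∉ m) → t ∈ l → ∃ n, TwoPth G C x z n := by
    intro p q u w l m hf hrl hrm htl
    obtain ⟨g1, g2, g3, g4, g5, g6, g7, g8, g9, g10⟩ := hf
    obtain ⟨l', k1, k2, k3, _⟩ := g1.suffix htl h6
    refine ⟨_, q, p, w, u, m, r ++ l', g2, hr.append k1 h4 (fun v a b => hrl v a (k2 v b)), g4, g3, 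
      g6, g5, g7.symm, g9, ?_, ?_, rfl⟩
    · intro v hv
      rcases List.mem_append.1 hv with hv | hv
      · exact hrC v hv
      · exact g8 v (k2 v hv)
    · intro v hv hv'
      rcases List.mem_append.1 hv' with hv' | hv'
      · exact hrm v hv' hv
      · exact k3 (g10 v (k2 v hv') hv ▸ hv')
  rcases h5 with (h5 | h5) | h5
  · by_cases htu : t = u
    · exact inC hf.symm hrm h5 (htu ▸ hf.2.2.2.2.2.2.1)
    · exact inC hf hrl h5 htu
  · exact inl2 hf hrl hrm h5
  · exact inl2 hf.symm hrm hrl h5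

theorem TwoConnected.boundary {V : Type*} [Fintype V] {G : SimpleGraph V} (h2 : TwoConnected G)
    (S : Set V) (a b : V) (ha : a ∈ S) (hb : b ∉ S) : ∃ x ∉ S, ∃ y ∈ S, G.Adj y x := by
  have hex : ∃ v, v ≠ a ∧ v ≠ b := by
    classical
    by_contra hcon
    push Not at hcon
    have : (Finset.univ : Finset V) ⊆ {a, b} := by
      intro v _
      simp
      by_cases h : v = a
      · exact Or.inl h
      · exact Or.inr (hcon v h)
    have h3 := Finset.card_le_card this
    have h4 : ({a, b} : Finset V).card ≤ 2 := Finset.card_le_two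
    have := h2.1
    rw [Finset.card_univ] at h3
    omega
  obtain ⟨v, hva, hvb⟩ := hex
  obtain ⟨r, e, t, hr, h1, h3, h4, h5, h6⟩ := hit_lemma h2 v b hvb.symm S a ha hva.symm hb
  exact ⟨e, h1 e hr.mem_right, t, h5, h4.symm⟩

theorem fan_exists {V : Type*} [Fintype V] {G : SimpleGraph V} (h2 : TwoConnected G)
    (C : Set V) (c0 c1 : V) (h0 : c0 ∈ C) (h1 : c1 ∈ C) (h01 : c0 ≠ c1) (x : V) (hx : x ∉ C) :
    ∃ p q u w l m, Fan G C x p q u w l m := by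
  by_contra hcon
  obtain ⟨x, hx, y, hy, hyx⟩ := h2.boundary
    (C ∪ {x | x ∉ C ∧ ∃ p q u w l m, Fan G C x p q u w l m}) c0 x (Or.inl h0) (by
      rintro (h | h)
      · exact hx h
      · exact hcon h.2)
  have hxC : x ∉ C := fun h => hx (Or.inl h)
  refine hx (Or.inr ⟨hxC, ?_⟩)
  rcases hy with hy | ⟨hyC, p, q, u, w, l, m, hf⟩
  · have : ∃ t0 ∈ C, t0 ≠ y := by
      by_cases h : c0 = y
      · exact ⟨c1, h1, fun h' => h01 (h.trans h'.symm)⟩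
      · exact ⟨c0, h0, h⟩
    obtain ⟨t0, ht0, ht0y⟩ := this
    obtain ⟨r, e, t, hr, k1, k3, k4, k5, k6⟩ := hit_lemma h2 y x hyx.ne' C t0 ht0 ht0y hxC
    exact ⟨x, e, y, t, [x], r, PathL.single G x, hr, hyx.symm, k4, hy, k5, k6.symm, by simpa using hxC,
      k1, by simp⟩
  · obtain ⟨n, p, q, u, w, l, m, g1, g2, g3, g4, g5, g6, g7, g8, g9, g10, g11⟩ := 
      aug_lemma h2 hf hyC x hxC hyx.ne'
    refine ⟨p, q, u, w, x :: l, m, g1.cons hyx.symm (fun h => g10 x h g2.mem_left), g2, g3, g4, g5, g6,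
      g7, ?_, g9, ?_⟩
    · intro v hv
      rcases List.mem_cons.1 hv with rfl | hv
      · exact hxC
      · exact g8 v hv
    · intro v hv hvm
      rcases List.mem_cons.1 hv with rfl | hv
      · rfl
      · exact absurd hvm (g10 v hv)

/-- Two disjoint paths from a set `D` to `C`, meeting `D` only in the starting points. -/
theorem two_paths {V : Type*} [Fintype V] {G : SimpleGraph V} (h2 : TwoConnected G)
    (C D : Set V) (c0 c1 : V) (h0 : c0 ∈ C) (h1 : c1 ∈ C) (h01 : c0 ≠ c1)
    (d0 d1 : V) (k0 : d0 ∈ D) (k1 : d1 ∈ D) (k01 : d0 ≠ d1) (hCD : ∀ x ∈ D, x ∉ C) :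
    ∃ x z p q u w l m, x ∈ D ∧ z ∈ D ∧ x ≠ z ∧ PathL G x p l ∧ PathL G z q m ∧
      G.Adj p u ∧ G.Adj q w ∧ u ∈ C ∧ w ∈ C ∧ u ≠ w ∧
      (∀ v ∈ l, v ∉ C) ∧ (∀ v ∈ m, v ∉ C) ∧ (∀ v ∈ l, v ∉ m) ∧
      (∀ v ∈ l, v ∈ D → v = x) ∧ (∀ v ∈ m, v ∈ D → v = z) := by
  classical
  have hex : ∃ n, ∃ x ∈ D, ∃ z ∈ D, TwoPth G C x z n := by
    obtain ⟨p, q, u, w, l, m, hf⟩ := fan_exists h2 C c0 c1 h0 h1 h01 d0 (hCD _ k0)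
    obtain ⟨n, hn⟩ := aug_lemma h2 hf (hCD _ k0) d1 (hCD _ k1) k01.symm
    exact ⟨n, d0, k0, d1, k1, hn⟩
  obtain ⟨x, hx, z, hz, p, q, u, w, l, m, g1, g2, g3, g4, g5, g6, g7, g8, g9, g10, g11⟩ :=
    Nat.find_spec hex
  have hmin := fun n => Nat.find_min hex (m := n)
  refine ⟨x, z, p, q, u, w, l, m, hx, hz, ?_, g1, g2, g3, g4, g5, g6, g7, g8, g9, g10, ?_, ?_⟩
  · rintro rfl; exact g10 x g1.mem_left g2.mem_left
  · intro v hv hvD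
    by_contra hvx
    obtain ⟨l', e1, e2, e3, e4⟩ := g1.suffix hv hvx
    exact hmin (l'.length + m.length) (by omega) ⟨v, hvD, z, hz, p, q, u, w, l', m, e1, g2, g3, g4, g5,
      g6, g7, fun y hy => g8 y (e2 y hy), g9, fun y hy => g10 y (e2 y hy), rfl⟩
  · intro v hv hvD
    by_contra hvx
    obtain ⟨l', e1, e2, e3, e4⟩ := g2.suffix hv hvx
    exact hmin (l.length + l'.length) (by omega) ⟨x, hx, v, hvD, p, q, u, w, l, l', g1, e1, g3, g4, g5,
      g6, g7, g8, fun y hy => g9 y (e2 y hy), fun y hy hy' => g10 y hy (e2 y hy'), rfl⟩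

structure Cyc {V : Type*} (G : SimpleGraph V) (f : ℤ → V) (c : ℕ) : Prop where
  three : 3 ≤ c
  per : Function.Periodic f (c : ℤ)
  adj : ∀ i, G.Adj (f i) (f (i + 1))
  inj : ∀ i j, f i = f j → (c : ℤ) ∣ i - j

def Mx {V : Type*} (G : SimpleGraph V) (c : ℕ) : Prop :=
  ∀ a b l, PathL G a b l → G.Adj b a → 3 ≤ l.length → l.length ≤ c

def seg {V : Type*} (f : ℤ → V) (i : ℤ) (n : ℕ) : List V :=
  (List.range n).map (fun t : ℕ => f (i + t))

theorem mem_seg {V : Type*} {f : ℤ → V} {i : ℤ} {n : ℕ} {v : V} :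
    v ∈ seg f i n ↔ ∃ t : ℕ, t < n ∧ f (i + t) = v := by
  simp [seg]

theorem length_seg {V : Type*} {f : ℤ → V} {i : ℤ} {n : ℕ} : (seg f i n).length = n := by
  simp [seg]

theorem Cyc.inj' {V : Type*} {G : SimpleGraph V} {f : ℤ → V} {c : ℕ} (h : Cyc G f c) {i j : ℤ}
    (hij : f i = f j) (h1 : i - j < c) (h2 : j - i < c) : i = j := by
  have := Int.eq_zero_of_abs_lt_dvd (h.inj _ _ hij) (by rw [abs_lt]; constructor <;> omega)
  omega

theorem Cyc.shift {V : Type*} {G : SimpleGraph V} {f : ℤ → V} {c : ℕ} (h : Cyc G f c) (r : ℤ) :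
    Cyc G (fun i => f (i + r)) c where
  three := h.three
  per := fun i => by
    have := h.per (i + r)
    show f _ = f _
    rw [← this]; congr 1; ring
  adj := fun i => by
    have := h.adj (i + r)
    convert this using 2; ring
  inj := fun i j hij => by
    have := h.inj _ _ hij
    convert this using 1; ring

theorem Cyc.neg {V : Type*} {G : SimpleGraph V} {f : ℤ → V} {c : ℕ} (h : Cyc G f c) :
    Cyc G (fun i => f (-i)) c where
  three := h.three
  per := fun i => by
    have := h.per (-(i + c))
    show f _ = f _
    rw [← this]; congr 1; ring
  adj := fun i => by
    have := (h.adj (-(i+1))).symm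
    show G.Adj (f _) (f _)
    convert this using 2; ring
  inj := fun i j hij => by
    have := h.inj _ _ hij
    have e : i - j = -(-i - -j) := by ring
    rw [e, dvd_neg]
    exact this

theorem Cyc.seg_path {V : Type*} {G : SimpleGraph V} {f : ℤ → V} {c : ℕ} (h : Cyc G f c) (i : ℤ) 
    (n : ℕ) (hn : n < c) : PathL G (f i) (f (i + n)) (seg f i (n + 1)) := by
  refine ⟨?_, ?_, ?_, ?_⟩
  · unfold seg
    rw [List.isChain_map, List.isChain_range_succ]
    intro m hm
    have := h.adj (i + m)
    convert this using 2; push_cast; ring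
  · unfold seg
    rw [List.nodup_map_iff_inj_on List.nodup_range]
    intro x hx y hy hxy
    simp at hx hy
    have := h.inj' hxy (by omega) (by omega)
    omega
  · simp [seg, List.range_succ_eq_map]
  · simp [seg, List.range_succ]

theorem Cyc.of_path {V : Type*} {G : SimpleGraph V} {a b : V} {l : List V} (h : PathL G a b l)
    (hab : G.Adj b a) (hl : 3 ≤ l.length) :
    ∃ f, Cyc G f l.length ∧ (∀ i, f i ∈ l) ∧ (∀ v ∈ l, v ∈ Set.range f) := by
  obtain ⟨c1, n1, s1, e1⟩ := h
  have hpos : (0 : ℤ) < l.length := by omega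
  have hb : ∀ i : ℤ, (i % l.length).toNat < l.length := fun i => by
    have := Int.emod_lt_of_pos i hpos
    have := Int.emod_nonneg i hpos.ne'
    omega
  refine ⟨fun i => l[(i % l.length).toNat]'(hb i), ⟨hl, ?_, ?_, ?_⟩, ?_, ?_⟩
  · intro i
    simp
  · intro i
    have h1 := Int.emod_lt_of_pos i hpos
    have h2 := Int.emod_nonneg i hpos.ne'
    have h3 : (i + 1) % l.length = (i % l.length + 1) % l.length := by simp
    by_cases hlast : i % l.length + 1 = l.length
    · have h4 : (i + 1) % l.length = 0 := by rw [h3, hlast]; simp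
      have e0 : l[0] = a := by
        rw [List.head?_eq_getElem?, List.getElem?_eq_getElem (by omega)] at s1
        simpa using s1
      have e2 : l[l.length - 1] = b := by
        rw [List.getLast?_eq_getElem?, List.getElem?_eq_getElem (by omega)] at e1
        simpa using e1
      have e3 : (i % l.length).toNat = l.length - 1 := by omega
      simp only [h4, e3, Int.toNat_zero]
      rw [e0, e2]; exact hab
    · have h4 : (i + 1) % l.length = i % l.length + 1 := by
        rw [h3]; exact Int.emod_eq_of_lt (by omega) (by omega)
      have h5 : ((i + 1) % l.length).toNat = (i % l.length).toNat + 1 := by omega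
      simp only [h5]
      exact List.isChain_iff_getElem.1 c1 _ (by omega)
  · intro i j hij
    have := (List.Nodup.getElem_inj_iff n1).1 hij
    have h2 := Int.emod_nonneg i hpos.ne'
    have h3 := Int.emod_nonneg j hpos.ne'
    apply Int.dvd_of_emod_eq_zero
    apply Int.emod_eq_emod_iff_emod_sub_eq_zero.1
    omega
  · intro i
    exact List.getElem_mem _
  · intro v hv
    obtain ⟨n, hn, rfl⟩ := List.getElem_of_mem hv
    refine ⟨n, ?_⟩
    have : ((n : ℤ) % l.length) = n := Int.emod_eq_of_lt (by omega) (by omega)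
    simp [this]

theorem Cyc.reps {V : Type*} {G : SimpleGraph V} {f : ℤ → V} {c : ℕ} (h : Cyc G f c) {u w : V}
    (hu : u ∈ Set.range f) (hw : w ∈ Set.range f) (huw : u ≠ w) :
    ∃ i : ℤ, ∃ n : ℕ, 0 < n ∧ n < c ∧ f i = u ∧ f (i + n) = w := by
  obtain ⟨i, rfl⟩ := hu
  obtain ⟨j, rfl⟩ := hw
  have hc : (0 : ℤ) < c := by have := h.three; omega
  have h1 := Int.emod_lt_of_pos (j - i) hc
  have h2 := Int.emod_nonneg (j - i) hc.ne'
  have key : f (i + (j - i) % c) = f j := by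
    have := h.per.int_mul ((j - i) / c) (i + (j - i) % c)
    rw [← this]
    congr 1
    have := Int.emod_add_mul_ediv (j - i) c
    push_cast
    linarith
  refine ⟨i, ((j - i) % c).toNat, ?_, by omega, rfl, ?_⟩
  · by_contra hcon
    have : (j - i) % c = 0 := by omega
    rw [this] at key
    simp at key
    exact huw key
  · rw [← key]; congr 2; omega

theorem ear_lemma {V : Type*} {G : SimpleGraph V} {f : ℤ → V} {c : ℕ} (h : Cyc G f c) (hm : Mx G c)
    {i j : ℤ} (hij : i < j) (hji : j < i + c) {p q : V} {e : List V} (he : PathL G p q e)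
    (hoff : ∀ v ∈ e, v ∉ Set.range f) (hp : G.Adj (f i) p) (hq : G.Adj q (f j)) :
    (e.length : ℤ) + 1 ≤ j - i := by
  have h1 := h.seg_path j (i + c - j).toNat (by omega)
  have e1 : f (j + (i + c - j).toNat) = f i := by
    rw [← h.per i]; congr 1; omega
  rw [e1] at h1
  have h2 := h1.append he hp (fun x hx hx' => hoff x hx' (by
    obtain ⟨t, _, rfl⟩ := mem_seg.1 hx; exact ⟨_, rfl⟩))
  have hpos : 1 ≤ e.length := List.length_pos_of_mem he.mem_left
  have := hm _ _ _ h2 hq (by simp [length_seg]; omega)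
  simp [length_seg] at this
  omega

theorem ear_both {V : Type*} {G : SimpleGraph V} {f : ℤ → V} {c : ℕ} (h : Cyc G f c) (hm : Mx G c)
    {u w : V} (hu : u ∈ Set.range f) (hw : w ∈ Set.range f) (huw : u ≠ w)
    {p q : V} {e : List V} (he : PathL G p q e)
    (hoff : ∀ v ∈ e, v ∉ Set.range f) (hp : G.Adj u p) (hq : G.Adj q w) :
    2 * e.length + 2 ≤ c := by
  obtain ⟨i, n, h1, h2, rfl, rfl⟩ := h.reps hu hw huw
  have k1 := ear_lemma h hm (i := i) (j := i + n) (by omega) (by omega) he hoff hp hq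
  have k2 := ear_lemma h hm (i := i + n) (j := i + c) (by omega) (by omega) he.reverse
    (by simpa using hoff) hq.symm (by rw [h.per i]; exact hp.symm)
  simp at k2
  omega

theorem cross_pre {V : Type*} {G : SimpleGraph V} {f : ℤ → V} {c : ℕ} (h : Cyc G f c)
    {i j : ℤ} {x : V} (hx : x ∉ Set.range f) (hxj : G.Adj x (f j))
    (a b : ℕ) (ha : 0 < a) (haj : i + a ≤ j) (hb : 0 < b) (hbi : j + b ≤ i + c) :
    ∃ l m, PathL G x (f (i + a)) l ∧ PathL G (f (j + b)) (f i) m ∧ (∀ v ∈ l, v ∉ m) ∧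
      (∀ v ∈ l, v = x ∨ v ∈ Set.range f) ∧ (∀ v ∈ m, v ∈ Set.range f) ∧
      (l.length : ℤ) = j - i - a + 2 ∧ (m.length : ℤ) = i + c - j - b + 1 := by
  have h1 := h.neg.seg_path (-j) (j - i - a).toNat (by omega)
  have h2 := h.seg_path (j + b) (i + c - j - b).toNat (by omega)
  have e1 : f (j + b + (i + c - j - b).toNat) = f i := by
    rw [← h.per i]; congr 1; omega
  rw [e1] at h2
  have e2 : f (-(-j + (j - i - a).toNat)) = f (i + a) := by congr 1; omega
  simp only [e2, neg_neg] at h1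
  have hr : ∀ v ∈ seg (fun i => f (-i)) (-j) ((j - i - a).toNat + 1), v ∈ Set.range f := by
    intro v hv
    obtain ⟨t, _, rfl⟩ := mem_seg.1 hv; exact ⟨_, rfl⟩
  have hr2 : ∀ v ∈ seg f (j + b) ((i + c - j - b).toNat + 1), v ∈ Set.range f := by
    intro v hv
    obtain ⟨t, _, rfl⟩ := mem_seg.1 hv; exact ⟨_, rfl⟩
  refine ⟨_, _, h1.cons hxj (fun hh => hx (hr _ hh)), h2, ?_, ?_, hr2, ?_, ?_⟩
  · intro v hv hv2
    rcases List.mem_cons.1 hv with rfl | hv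
    · exact hx (hr2 _ hv2)
    · obtain ⟨t, ht, rfl⟩ := mem_seg.1 hv
      obtain ⟨s, hs, hst⟩ := mem_seg.1 hv2
      have := h.inj' hst (by omega) (by omega)
      omega
  · intro v hv
    rcases List.mem_cons.1 hv with rfl | hv
    · exact Or.inl rfl
    · exact Or.inr (hr _ hv)
  · simp [length_seg]; omega
  · simp [length_seg]; omega

theorem cross_adj {V : Type*} {G : SimpleGraph V} {f : ℤ → V} {c : ℕ} (h : Cyc G f c) (hm : Mx G c)
    {i j : ℤ} {x : V} (hx : x ∉ Set.range f) (hxi : G.Adj x (f i)) (hxj : G.Adj x (f j))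
    (hij : i < j) (hbi : j < i + c) : ¬ G.Adj (f (i + 1)) (f (j + 1)) := by
  intro hadj
  obtain ⟨l, m, h1, h2, h3, h4, h5, h6, h7⟩ := cross_pre h (i := i) hx hxj 1 1 (by simp) (by simp; omega) 
    (by simp) (by simp; omega)
  have := hm _ _ _ (h1.append h2 (by simpa using hadj) h3) hxi.symm (by simp; omega)
  simp at this
  omega

theorem cross_off {V : Type*} {G : SimpleGraph V} {f : ℤ → V} {c : ℕ} (h : Cyc G f c) (hm : Mx G c)
    {i j : ℤ} {x y : V} (hx : x ∉ Set.range f) (hxi : G.Adj x (f i)) (hxj : G.Adj x (f j))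
    (a b : ℕ) (ha : 0 < a) (haj : i + a ≤ j) (hb : 0 < b) (hbi : j + b ≤ i + c) (hab : a + b ≤ 3)
    (hy : y ∉ Set.range f) (hyx : y ≠ x) (hy1 : G.Adj y (f (i + a))) (hy2 : G.Adj y (f (j + b))) :
    False := by
  obtain ⟨l, m, h1, h2, h3, h4, h5, h6, h7⟩ := cross_pre h (i := i) hx hxj a b ha haj hb hbi
  have h8 := h2.cons hy2 (fun hh => hy (h5 _ hh))
  have := hm _ _ _ (h1.append h8 hy1.symm (by
    intro v hv hv2
    rcases List.mem_cons.1 hv2 with rfl | hv2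
    · rcases h4 v hv with h | h
      · exact hyx h
      · exact hy h
    · exact h3 v hv hv2)) hxi.symm (by simp; omega)
  simp at this
  omega

theorem two_cycles {V : Type*} [Fintype V] {G : SimpleGraph V} (h2 : TwoConnected G)
    {f g : ℤ → V} {c d : ℕ} (h : Cyc G f c) (hm : Mx G c) (hg : Cyc G g d) (hd : 4 ≤ d)
    (hdis : ∀ i, g i ∉ Set.range f) : d + 4 ≤ c := by
  have ne1 : f 0 ≠ f 1 := by have := (h.adj 0).ne; simpa using this
  have ne2 : g 0 ≠ g 1 := by have := (hg.adj 0).ne; simpa using this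
  obtain ⟨x, z, p, q, u, w, l, m, hx, hz, hxz, g1, g2, g3, g4, g5, g6, g7, g8, g9, g10, g11, g12⟩ :=
    two_paths h2 (Set.range f) (Set.range g) (f 0) (f 1) ⟨_, rfl⟩ ⟨_, rfl⟩ ne1 (g 0) (g 1) 
      ⟨_, rfl⟩ ⟨_, rfl⟩ ne2 (by rintro _ ⟨i, rfl⟩; exact hdis i)
  obtain ⟨i, n, k1, k2, rfl, rfl⟩ := hg.reps hx hz hxz
  have key : ∀ (i : ℤ) (n : ℕ) (p q u w : V) (l m : List V), 2 ≤ n → n < d → PathL G (g i) p l → 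
      PathL G (g (i + n)) q m → G.Adj p u → G.Adj q w → u ∈ Set.range f → w ∈ Set.range f → u ≠ w → 
      (∀ v ∈ l, v ∉ Set.range f) → (∀ v ∈ m, v ∉ Set.range f) → (∀ v ∈ l, v ∉ m) → 
      (∀ v ∈ l, v ∈ Set.range g → v = g i) → (∀ v ∈ m, v ∈ Set.range g → v = g (i + n)) →
      2 * n + 4 ≤ c := by
    clear * - h hm hg hdis
    intro i n p q u w l m hn hnd g1 g2 g3 g4 g5 g6 g7 g8 g9 g10 g11 g12
    have hs := hg.seg_path (i + 1) (n - 2) (by omega)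
    have hsr : ∀ v ∈ seg g (i + 1) (n - 2 + 1), v ∈ Set.range g := by
      intro v hv
      obtain ⟨t, _, rfl⟩ := mem_seg.1 hv; exact ⟨_, rfl⟩
    have hsi : g i ∉ seg g (i + 1) (n - 2 + 1) := by
      intro hv
      obtain ⟨t, ht, hh⟩ := mem_seg.1 hv
      have := hg.inj' hh (by omega) (by omega)
      omega
    have hsn : g (i + n) ∉ seg g (i + 1) (n - 2 + 1) := by
      intro hv
      obtain ⟨t, ht, hh⟩ := mem_seg.1 hv
      have := hg.inj' hh (by omega) (by omega)
      omega
    have a1 := g1.reverse.append hs (hg.adj i) (by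
      intro v hv hv'
      have := g11 v (by simpa using hv) (hsr v hv')
      exact hsi (this ▸ hv'))
    have hadj : G.Adj (g (i + 1 + ((n - 2 : ℕ) : ℤ))) (g (i + n)) := by
      have := hg.adj (i + n - 1)
      convert this using 2 <;> omega
    have a2 := a1.append g2 hadj (by
      intro v hv hv'
      rcases List.mem_append.1 hv with hv | hv
      · exact g10 v (by simpa using hv) hv'
      · exact hsn (g12 v hv' (hsr v hv) ▸ hv))
    have := ear_both h hm g5 g6 g7 a2 (by
      intro v hv
      rcases List.mem_append.1 hv with hv | hv
      · rcases List.mem_append.1 hv with hv | hv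
        · exact g8 v (by simpa using hv)
        · obtain ⟨t, rfl⟩ := hsr v hv
          exact hdis t
      · exact g9 v hv) g3.symm g4
    have hl1 := List.length_pos_of_mem g1.mem_left
    have hl2 := List.length_pos_of_mem g2.mem_left
    simp [length_seg] at this
    omega
  by_cases hh : d ≤ 2 * n
  · have := key i n p q u w l m (by omega) k2 g1 g2 g3 g4 g5 g6 g7 g8 g9 g10 g11 g12
    omega
  · have e : g (i + n + ((d - n : ℕ) : ℤ)) = g i := by
      rw [← hg.per i]; congr 1; omega
    have := key (i + n) (d - n) q p w u m l (by omega) (by omega) g2 (by rw [e]; exact g1) g4 g3 g6 g5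
      g7.symm g9 g8 (fun v a b => g10 v b a) g12 (by rw [e]; exact g11)
    omega

theorem nc_lemma (S : Finset ℕ) (a b : ℕ) (hS : S ⊆ Finset.Ico a b) (hnc : ∀ i ∈ S, i + 1 ∉ S)
    : 2 * S.card ≤ b - a + 1 := by
  have hd : Disjoint S (S.image (· + 1)) := by
    rw [Finset.disjoint_left]
    intro i hi hi'
    obtain ⟨j, hj, rfl⟩ := Finset.mem_image.1 hi'
    exact hnc j hj hi
  have hc : (S.image (· + 1)).card = S.card := Finset.card_image_of_injective _ (add_left_injective 1)
  have hsub : S ∪ S.image (· + 1) ⊆ Finset.Ico a (b + 1) := by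
    intro i hi
    rcases Finset.mem_union.1 hi with hi | hi
    · have := Finset.mem_Ico.1 (hS hi)
      exact Finset.mem_Ico.2 (by omega)
    · obtain ⟨j, hj, rfl⟩ := Finset.mem_image.1 hi
      have := Finset.mem_Ico.1 (hS hj)
      exact Finset.mem_Ico.2 (by omega)
  have := Finset.card_le_card hsub
  rw [Finset.card_union_of_disjoint hd, hc, Nat.card_Ico] at this
  omega

theorem filter_split (P : ℕ → Prop) [DecidablePred P] {a b c : ℕ} (h1 : a ≤ b) (h2 : b ≤ c) :
    ((Finset.Ico a c).filter P).card =
      ((Finset.Ico a b).filter P).card + ((Finset.Ico b c).filter P).card := by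
  simp only [Finset.card_filter]
  exact (Finset.sum_Ico_consecutive _ h1 h2).symm

theorem lin_lemma (A B : ℕ → Prop) [DecidablePred (fun i => A i ∨ B i)] (s lo hi : ℕ)
    (h1 : ∀ i j, lo ≤ i → i < j → j ≤ hi → (A i ∨ B i) → (A j ∨ B j) → i + 2 ≤ j)
    (h2 : ∀ i j, lo ≤ i → i < j → j ≤ hi → (A i ∧ B j ∨ B i ∧ A j) → i + s + 2 ≤ j) :
    ∀ n a b, b - a ≤ n → lo ≤ a → a < b → b ≤ hi → (A a ∧ B b ∨ B a ∧ A b) →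
      2 * ((Finset.Ico a b).filter (fun i => A i ∨ B i)).card + s ≤ b - a := by
  have plain : ∀ a b, lo ≤ a → a ≤ b → b ≤ hi → (A b ∨ B b) →
      2 * ((Finset.Ico a b).filter (fun i => A i ∨ B i)).card ≤ b - a := by
    intro a b ha hab hb hbb
    have := nc_lemma ((Finset.Ico a (b + 1)).filter (fun i => A i ∨ B i)) a (b + 1)
      (Finset.filter_subset _ _) (by
        intro i hi hi'
        simp only [Finset.mem_filter, Finset.mem_Ico] at hi hi'
        have := h1 i (i + 1) (by omega) (by omega) (by omega) hi.2 hi'.2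
        omega)
    rw [filter_split _ hab (by omega : b ≤ b + 1)] at this
    have h3 : ((Finset.Ico b (b + 1)).filter (fun i => A i ∨ B i)).card = 1 := by
      rw [Finset.card_eq_one]
      refine ⟨b, ?_⟩
      ext i
      simp only [Finset.mem_filter, Finset.mem_Ico, Finset.mem_singleton]
      constructor
      · intro h; omega
      · rintro rfl; exact ⟨by omega, hbb⟩
    omega
  intro n
  induction n with
  | zero => intro a b h _ h'; omega
  | succ n ih =>
    intro a b hn ha hab hb hAB
    by_cases hz : ∃ z, a < z ∧ z < b ∧ (A z ∨ B z)
    · obtain ⟨z, hz1, hz2, hz3⟩ := hz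
      rw [filter_split _ hz1.le hz2.le]
      have hAz : (A a ∧ B z ∨ B a ∧ A z) ∨ (A z ∧ B b ∨ B z ∧ A b) := by tauto
      rcases hAz with h | h
      · have := ih a z (by omega) ha hz1 (by omega) h
        have := plain z b (by omega) hz2.le hb (by tauto)
        omega
      · have := ih z b (by omega) (by omega) hz2 (by omega) h
        have := plain a z (by omega) hz1.le (by omega) (by tauto)
        omega
    · have h3 : ((Finset.Ico a b).filter (fun i => A i ∨ B i)).card ≤ 1 := by
        rw [Finset.card_le_one]
        have : ∀ i ∈ ((Finset.Ico a b).filter (fun i => A i ∨ B i)), i = a := by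
          intro i hi
          simp only [Finset.mem_filter, Finset.mem_Ico] at hi
          by_contra hne
          exact hz ⟨i, by omega, by omega, hi.2⟩
        intro i hi j hj
        rw [this i hi, this j hj]
      have := h2 a b ha hab hb hAB
      omega

theorem Cyc.mem_range {V : Type*} {G : SimpleGraph V} {f : ℤ → V} {c : ℕ} (h : Cyc G f c) {v : V}
    (hv : v ∈ Set.range f) (i : ℤ) : ∃ t : ℕ, t < c ∧ f (i + t) = v := by
  by_cases hvi : f i = v
  · exact ⟨0, by have := h.three; omega, by simpa using hvi⟩
  · have h' := h.shift i
    have : ∃ j, f (j + i) = v := by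
      obtain ⟨j, rfl⟩ := hv
      exact ⟨j - i, by simp⟩
    obtain ⟨i', n, h1, h2, h3, h4⟩ := h.reps ⟨i, rfl⟩ hv hvi
    have := h.inj _ _ h3
    obtain ⟨m, hm⟩ := this
    refine ⟨n, h2, ?_⟩
    rw [← h4, ← h.per.int_mul m (i + n)]
    congr 1
    simp
    linarith

theorem Cyc.card_le {V : Type*} {G : SimpleGraph V} {f : ℤ → V} {c : ℕ} (h : Cyc G f c)
    [DecidableEq V] (S : Finset V) (hS : ∀ v ∈ S, v ∈ Set.range f) (i : ℤ) :
    S.card ≤ ((Finset.Ico 0 c).filter (fun t : ℕ => f (i + t) ∈ S)).card := by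
  have : S ⊆ ((Finset.Ico 0 c).filter (fun t : ℕ => f (i + t) ∈ S)).image (fun t : ℕ => f (i + t)) := by
    intro v hv
    obtain ⟨t, ht, rfl⟩ := h.mem_range (hS v hv) i
    exact Finset.mem_image.2 ⟨t, by simp [ht, hv], rfl⟩
  exact (Finset.card_le_card this).trans Finset.card_image_le

theorem tri {V : Type*} {G : SimpleGraph V} (htf : G.CliqueFree 3) {a b c : V} (h1 : G.Adj a b)
    (h2 : G.Adj b c) (h3 : G.Adj a c) : False := by
  classical
  exact htf {a, b, c} (SimpleGraph.is3Clique_triple_iff.2 ⟨h1, h3, h2⟩)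

theorem end_lemma {V : Type*} {G : SimpleGraph V} (htf : G.CliqueFree 3) {a b : V} {l : List V}
    (h : PathL G a b l) (F : Finset V) (hF : F.Nonempty) (hFa : ∀ v ∈ F, G.Adj a v ∧ v ∈ l) :
    ∃ b' l', PathL G a b' l' ∧ (∀ v ∈ l', v ∈ l) ∧ 2 * F.card ≤ l'.length ∧ G.Adj b' a := by
  classical
  obtain ⟨v, hv, hmax⟩ := F.exists_max_image (fun v => l.idxOf v) hF
  have hvl := (hFa v hv).2
  have hlt := List.idxOf_lt_length_iff.2 hvl
  obtain ⟨c1, n1, s1, e1⟩ := h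
  have hget : ∀ w (hw : w ∈ l), l[l.idxOf w]'(List.idxOf_lt_length_iff.2 hw) = w :=
    fun w hw => List.getElem_idxOf _
  refine ⟨v, l.take (l.idxOf v + 1), ⟨c1.take _, ?_, ?_, ?_⟩, ?_, ?_, (hFa v hv).1.symm⟩
  · exact n1.sublist (List.take_sublist _ _)
  · rw [List.head?_take]; simpa using s1
  · rw [List.getLast?_take]
    simp [List.getElem?_eq_getElem hlt]
  · intro w hw; exact List.mem_of_mem_take hw
  · have hc : (F.image (fun v => l.idxOf v)).card = F.card := by
      apply Finset.card_image_of_injOn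
      intro x hx y hy hxy
      exact (List.idxOf_inj (hFa x hx).2).1 hxy
    have := nc_lemma (F.image (fun v => l.idxOf v)) 1 (l.idxOf v + 1) (by
      intro i hi
      obtain ⟨w, hw, rfl⟩ := Finset.mem_image.1 hi
      have h1 := hmax w hw
      simp only [Finset.mem_Ico]
      refine ⟨?_, by omega⟩
      by_contra h0
      have h0 : l.idxOf w = 0 := by omega
      have h3 := hget w (hFa w hw).2
      have h4 := (hFa w hw).1.ne
      rw [List.head?_eq_getElem?, List.getElem?_eq_getElem (by omega)] at s1
      simp [h0] at h3 s1
      exact h4 (s1.symm.trans h3)) (by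
      intro i hi hi'
      obtain ⟨w, hw, rfl⟩ := Finset.mem_image.1 hi
      obtain ⟨y, hy, hyw⟩ := Finset.mem_image.1 hi'
      have h3 := hget w (hFa w hw).2
      have h4 := hget y (hFa y hy).2
      have h5 := List.isChain_iff_getElem.1 c1 (l.idxOf w)
        (by rw [← hyw]; exact List.idxOf_lt_length_iff.2 (hFa y hy).2)
      simp only [← hyw] at h5
      rw [h3, h4] at h5
      exact tri htf (hFa w hw).1 h5 (hFa y hy).1)
    rw [hc] at this
    rw [List.length_take]
    omega

theorem exists_longest {V : Type*} [Fintype V] (G : SimpleGraph V) (X : Set V) (a b : V) (l : List V)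
    (h : PathL G a b l) (hX : ∀ v ∈ l, v ∉ X) :
    ∃ a b m, PathL G a b m ∧ (∀ v ∈ m, v ∉ X) ∧ l.length ≤ m.length ∧
      (∀ v, v ∉ X → G.Adj a v → v ∈ m) ∧ (∀ v, v ∉ X → G.Adj b v → v ∈ m) := by
  classical
  let P : ℕ → Prop := fun n => ∃ a b m, PathL G a b m ∧ (∀ v ∈ m, v ∉ X) ∧ m.length = n
  have hP : P l.length := ⟨a, b, l, h, hX, rfl⟩
  have hb : ∀ n, P n → n ≤ Fintype.card V := by
    rintro n ⟨a, b, m, hm, _, rfl⟩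
    exact hm.2.1.length_le_card
  have hsp := Nat.findGreatest_spec (P := P) (hb _ hP) hP
  obtain ⟨a, b, m, hm, h1, h2⟩ := hsp
  have hmax : ∀ n, P n → n ≤ m.length := fun n hn => by
    rw [h2]; exact Nat.le_findGreatest (hb n hn) hn
  have key : ∀ a b m', PathL G a b m' → (∀ v ∈ m', v ∉ X) → m'.length = m.length →
      ∀ v, v ∉ X → G.Adj a v → v ∈ m' := by
    intro a b m' hm' h1 h2 v hv hav
    by_contra hvm
    have := hmax (m'.length + 1) ⟨v, b, v :: m', hm'.cons hav.symm hvm, by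
      intro w hw
      rcases List.mem_cons.1 hw with rfl | hw
      · exact hv
      · exact h1 w hw, by simp⟩
    omega
  refine ⟨a, b, m, hm, h1, hmax _ hP, key a b m hm h1 rfl, ?_⟩
  intro v hv hbv
  have := key b a m.reverse hm.reverse (by simpa using h1) (by simp) v hv hbv
  simpa using this

theorem off_indep {V : Type*} [Fintype V] (k : ℕ) (hk : 3 ≤ k)
    (G : SimpleGraph V) [DecidableRel G.Adj]
    (h2 : TwoConnected G) (hdeg : ∀ v : V, k ≤ G.degree v) (htf : G.CliqueFree 3)
    {f : ℤ → V} {c : ℕ} (h : Cyc G f c) (hm : Mx G c) (hc : c ≤ 2 * k + 1) {y z : V}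
    (hy : y ∉ Set.range f) (hz : z ∉ Set.range f) : ¬ G.Adj y z := by
  classical
  intro hyz
  obtain ⟨a, b, l, hl, hX, hlen, ha, hb⟩ := exists_longest G (Set.range f) y z [y, z]
    ((PathL.single G z).cons hyz (by simpa using hyz.ne)) (by
      intro v hv
      simp only [List.mem_cons, List.not_mem_nil, or_false] at hv
      rcases hv with rfl | rfl
      · exact hy
      · exact hz)
  simp at hlen
  have main : ∀ a b l, PathL G a b l → (∀ v ∈ l, v ∉ Set.range f) →
      (∀ v, v ∉ Set.range f → G.Adj a v → v ∈ l) → 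
      2 ≤ ((G.neighborFinset a).filter (· ∈ Set.range f)).card ∧ 
      2 * k ≤ l.length + 2 * ((G.neighborFinset a).filter (· ∈ Set.range f)).card := by
    intro a b l hl hX ha
    have hcard := Finset.card_filter_add_card_filter_not (s := G.neighborFinset a) (· ∈ Set.range f)
    rw [SimpleGraph.card_neighborFinset_eq_degree] at hcard
    have hda := hdeg a
    by_cases hF : ((G.neighborFinset a).filter (fun v => ¬ v ∈ Set.range f)).Nonempty
    · obtain ⟨b', l', g1, g2, g3, g4⟩ := end_lemma htf hl _ hF (by
        intro v hv
        simp only [Finset.mem_filter, SimpleGraph.mem_neighborFinset] at hv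
        exact ⟨hv.1, ha v hv.2 hv.1⟩)
      have hll : l'.length ≤ l.length := (g1.2.1.subperm g2).length_le
      refine ⟨?_, by omega⟩
      by_contra hcon
      have h4 : 2 * k - 2 ≤ l'.length := by omega
      obtain ⟨g, hg, hg1, _⟩ := Cyc.of_path g1 g4 (by omega)
      have := two_cycles h2 h hm hg (by omega) (fun i => hX _ (g2 _ (hg1 i)))
      omega
    · rw [Finset.not_nonempty_iff_eq_empty] at hF
      rw [hF, Finset.card_empty] at hcard
      omega
  obtain ⟨u1, u2⟩ := main a b l hl hX ha
  obtain ⟨w1, w2⟩ := main b a l.reverse hl.reverse (by simpa using hX) (by simpa using hb)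
  rw [List.length_reverse] at w2
  set U := (G.neighborFinset a).filter (· ∈ Set.range f) with hU
  set W := (G.neighborFinset b).filter (· ∈ Set.range f) with hW
  have mU : ∀ v, v ∈ U ↔ G.Adj a v ∧ v ∈ Set.range f := by intro v; simp [hU]
  have mW : ∀ v, v ∈ W ↔ G.Adj b v ∧ v ∈ Set.range f := by intro v; simp [hW]
  obtain ⟨w0, hw0⟩ : W.Nonempty := Finset.card_pos.1 (by omega)
  obtain ⟨u0, hu0, huw⟩ := Finset.exists_mem_ne (by omega : 1 < U.card) w0
  obtain ⟨i, n, n0, nc, rfl, rfl⟩ := h.reps ((mU _).1 hu0).2 ((mW _).1 hw0).2 huw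
  have hlin := fun lo hi (hlh : hi < lo + c) => lin_lemma (fun t : ℕ => f (i + t) ∈ U)
    (fun t : ℕ => f (i + t) ∈ W) (l.length - 1) lo hi (by
      intro s t hs hst ht h1 h3
      rw [mU, mW] at h1 h3
      rcases h1 with h1 | h1 <;> rcases h3 with h3 | h3
      · have := ear_lemma h hm (i := i + s) (j := i + t) (by omega) (by omega) (PathL.single G a)
          (by simpa using hX a hl.mem_left) h1.1.symm h3.1
        simp at this; omega
      · have := ear_lemma h hm (i := i + s) (j := i + t) (by omega) (by omega) hl
          hX h1.1.symm h3.1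
        omega
      · have := ear_lemma h hm (i := i + s) (j := i + t) (by omega) (by omega) hl.reverse
          (by simpa using hX) h1.1.symm h3.1
        simp at this; omega
      · have := ear_lemma h hm (i := i + s) (j := i + t) (by omega) (by omega) (PathL.single G b)
          (by simpa using hX b hl.mem_right) h1.1.symm h3.1
        simp at this; omega) (by
      intro s t hs hst ht h1
      rw [mU, mW, mU, mW] at h1
      rcases h1 with ⟨h1, h3⟩ | ⟨h1, h3⟩
      · have := ear_lemma h hm (i := i + s) (j := i + t) (by omega) (by omega) hl
          hX h1.1.symm h3.1
        omega
      · have := ear_lemma h hm (i := i + s) (j := i + t) (by omega) (by omega) hl.reverse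
          (by simpa using hX) h1.1.symm h3.1
        simp at this; omega) 
  have r1 := hlin 0 n (by omega) n 0 n (by omega) (by omega) n0 le_rfl (Or.inl ⟨by simpa using hu0, hw0⟩)
  have r2 := hlin n c (by omega) c n c (by omega) le_rfl nc le_rfl (Or.inr ⟨hw0, by rw [h.per i]; exact hu0⟩)
  have r3 := h.card_le (U ∪ W) (by
    intro v hv
    rcases Finset.mem_union.1 hv with hv | hv
    · exact ((mU v).1 hv).2
    · exact ((mW v).1 hv).2) i
  simp only [Finset.mem_union] at r3
  rw [filter_split _ (Nat.zero_le n) nc.le] at r3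
  by_cases hl2 : l.length = 2
  · have hab : G.Adj a b := by
      obtain ⟨c1, n1, s1, e1⟩ := hl
      match l, hl2 with
      | [x, y], _ =>
        simp at s1 e1 c1
        subst s1 e1
        exact c1
    have hd : Disjoint U W := by
      rw [Finset.disjoint_left]
      intro v hv hv'
      exact tri htf hab ((mW v).1 hv').1 ((mU v).1 hv).1
    rw [Finset.card_union_of_disjoint hd] at r3
    omega
  · have := Finset.card_le_card (Finset.subset_union_left : U ⊆ U ∪ W)
    omega

theorem iso_lemma {V : Type*} [Fintype V] (k : ℕ) (hk : 3 ≤ k)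
    (G : SimpleGraph V) [DecidableRel G.Adj]
    (hdeg : ∀ v : V, k ≤ G.degree v) (htf : G.CliqueFree 3)
    (A : Finset V) (hA : A.card = k) (hN : ∀ v, v ∉ A → ∀ w, G.Adj v w ↔ w ∈ A) :
    ∃ n : ℕ, k ≤ n ∧ Nonempty (G ≃g completeBipartiteGraph (Fin k) (Fin n)) := by
  classical
  obtain ⟨a, ha⟩ : A.Nonempty := Finset.card_pos.1 (by omega)
  have hb : ∃ b, b ∉ A := by
    by_contra hcon
    push Not at hcon
    have : A = Finset.univ := Finset.eq_univ_iff_forall.2 hcon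
    have h1 := G.degree_lt_card_verts a
    rw [← Finset.card_univ, ← this, hA] at h1
    have := hdeg a
    omega
  obtain ⟨b, hb⟩ := hb
  have hind : ∀ x ∈ A, ∀ y ∈ A, ¬ G.Adj x y := fun x hx y hy hxy =>
    tri htf ((hN b hb x).2 hx) hxy ((hN b hb y).2 hy)
  have hn : k ≤ (Aᶜ).card := by
    refine (hdeg a).trans ?_
    rw [← SimpleGraph.card_neighborFinset_eq_degree]
    apply Finset.card_le_card
    intro w hw
    rw [SimpleGraph.mem_neighborFinset] at hw
    rw [Finset.mem_compl]
    exact fun hwA => hind a ha w hwA hw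
  refine ⟨(Aᶜ).card, hn, ?_⟩
  let e1 : {v // v ∈ A} ≃ Fin k := Fintype.equivFinOfCardEq (by simpa using hA)
  let e2 : {v // ¬ v ∈ A} ≃ Fin (Aᶜ).card := Fintype.equivFinOfCardEq (by
    rw [Fintype.card_subtype_compl, Finset.card_compl]; simp)
  let e : V ≃ Fin k ⊕ Fin (Aᶜ).card := (Equiv.sumCompl (· ∈ A)).symm.trans (Equiv.sumCongr e1 e2)
  have eA : ∀ v (hv : v ∈ A), e v = Sum.inl (e1 ⟨v, hv⟩) := by
    intro v hv
    simp [e, Equiv.sumCompl_symm_apply_of_pos hv]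
  have eB : ∀ v (hv : ¬ v ∈ A), e v = Sum.inr (e2 ⟨v, hv⟩) := by
    intro v hv
    simp [e, Equiv.sumCompl_symm_apply_of_neg hv]
  refine ⟨⟨e, ?_⟩⟩
  intro x y
  by_cases hx : x ∈ A <;> by_cases hy : y ∈ A
  · rw [eA x hx, eA y hy]
    simpa using hind x hx y hy
  · rw [eA x hx, eB y hy]
    simpa using ((hN y hy x).2 hx).symm
  · rw [eB x hx, eA y hy]
    simpa using (hN x hx y).2 hy
  · rw [eB x hx, eB y hy]
    simpa using fun h => hy ((hN x hx y).1 h)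

theorem bip_lemma {V : Type*} [Fintype V] (k : ℕ) (hk : 3 ≤ k)
    (G : SimpleGraph V) [DecidableRel G.Adj]
    (hdeg : ∀ v : V, k ≤ G.degree v) (htf : G.CliqueFree 3) (hcard : Fintype.card V ≤ 2 * k + 1)
    (u : V) (X : Finset V) (hX : ∀ a ∈ X, ∀ b ∈ X, ¬ G.Adj a b) 
    (hY : ∀ a, a ∉ X → ∀ b, b ∉ X → ¬ G.Adj a b) :
    ∃ n : ℕ, k ≤ n ∧ Nonempty (G ≃g completeBipartiteGraph (Fin k) (Fin n)) := by
  classical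
  have hXs : ∀ a ∈ X, G.neighborFinset a ⊆ Xᶜ := by
    intro a ha w hw
    rw [SimpleGraph.mem_neighborFinset] at hw
    rw [Finset.mem_compl]; exact fun h => hX a ha w h hw
  have hYs : ∀ a, a ∉ X → G.neighborFinset a ⊆ X := by
    intro a ha w hw
    rw [SimpleGraph.mem_neighborFinset] at hw
    by_contra h; exact hY a ha w h hw
  have h1 : ∀ a ∈ X, k ≤ (Xᶜ).card := fun a ha => by
    have := Finset.card_le_card (hXs a ha)
    rw [SimpleGraph.card_neighborFinset_eq_degree] at this
    exact (hdeg a).trans this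
  have h2 : ∀ a, a ∉ X → k ≤ X.card := fun a ha => by
    have := Finset.card_le_card (hYs a ha)
    rw [SimpleGraph.card_neighborFinset_eq_degree] at this
    exact (hdeg a).trans this
  have h12 : k ≤ X.card ∧ k ≤ (Xᶜ).card := by
    by_cases hu : u ∈ X
    · have h3 := h1 u hu
      obtain ⟨w, hw⟩ : (Xᶜ).Nonempty := Finset.card_pos.1 (by omega)
      exact ⟨h2 w (Finset.mem_compl.1 hw), h3⟩
    · have h3 := h2 u hu
      obtain ⟨w, hw⟩ : X.Nonempty := Finset.card_pos.1 (by omega)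
      exact ⟨h3, h1 w hw⟩
  have h3 := Finset.card_add_card_compl X
  by_cases hc : X.card = k
  · refine iso_lemma k hk G hdeg htf X hc ?_
    intro v hv w
    have := Finset.eq_of_subset_of_card_le (hYs v hv) (by 
      rw [SimpleGraph.card_neighborFinset_eq_degree, hc]; exact hdeg v)
    rw [← this, SimpleGraph.mem_neighborFinset]
  · have hc' : (Xᶜ).card = k := by omega
    refine iso_lemma k hk G hdeg htf Xᶜ hc' ?_
    intro v hv w
    have := Finset.eq_of_subset_of_card_le (hXs v (by simpa using hv)) (by 
      rw [SimpleGraph.card_neighborFinset_eq_degree, hc']; exact hdeg v)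
    rw [← this, SimpleGraph.mem_neighborFinset]

theorem small_lemma {V : Type*} [Fintype V] (k : ℕ) (hk : 3 ≤ k)
    (G : SimpleGraph V) [DecidableRel G.Adj]
    (hdeg : ∀ v : V, k ≤ G.degree v) (htf : G.CliqueFree 3) (hcard : Fintype.card V ≤ 2 * k + 1)
    (u : V) :
    ∃ n : ℕ, k ≤ n ∧ Nonempty (G ≃g completeBipartiteGraph (Fin k) (Fin n)) := by
  classical
  have hdeg' : ∀ v, k ≤ (G.neighborFinset v).card := fun v => by
    rw [SimpleGraph.card_neighborFinset_eq_degree]; exact hdeg v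
  obtain ⟨v, hv⟩ : (G.neighborFinset u).Nonempty := Finset.card_pos.1 (by have := hdeg' u; omega)
  rw [SimpleGraph.mem_neighborFinset] at hv
  have ind : ∀ z, ∀ a ∈ G.neighborFinset z, ∀ b ∈ G.neighborFinset z, ¬ G.Adj a b := by
    intro z a ha b hb hab
    rw [SimpleGraph.mem_neighborFinset] at ha hb
    exact tri htf ha hab hb
  have hdis : Disjoint (G.neighborFinset u) (G.neighborFinset v) := by
    rw [Finset.disjoint_left]
    intro a ha hb
    rw [SimpleGraph.mem_neighborFinset] at ha hb
    exact tri htf hv hb ha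
  set X := G.neighborFinset u with hXdef
  set Y := G.neighborFinset v with hYdef
  have hXi := ind u
  have hYi := ind v
  have hXk := hdeg' u
  have hYk := hdeg' v
  rw [← hXdef] at hXi hXk
  rw [← hYdef] at hYi hYk
  by_cases hw : ∃ w, w ∉ X ∧ w ∉ Y
  · obtain ⟨w, hwX, hwY⟩ := hw
    have hU : ∀ z, z ∈ X ∨ z ∈ Y ∨ z = w := by
      intro z
      by_contra hcon
      push Not at hcon
      have h1 : (insert z (insert w (X ∪ Y))).card ≤ Fintype.card V := Finset.card_le_univ _
      rw [Finset.card_insert_of_notMem (by simp; tauto), Finset.card_insert_of_notMem (by simp; tauto),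
        Finset.card_union_of_disjoint hdis] at h1
      omega
    have hXY : X.card + Y.card ≤ 2 * k := by
      have h1 : (insert w (X ∪ Y)).card ≤ Fintype.card V := Finset.card_le_univ _
      rw [Finset.card_insert_of_notMem (by simp; tauto),
        Finset.card_union_of_disjoint hdis] at h1
      omega
    by_cases hx0 : ∃ x0 ∈ X, G.Adj w x0
    · by_cases hy0 : ∃ y0 ∈ Y, G.Adj w y0
      · exfalso
        have key : ∀ (X Y : Finset V), (∀ a ∈ X, ∀ b ∈ X, ¬ G.Adj a b) → 
            (∀ z, z ∈ X ∨ z ∈ Y ∨ z = w) → Y.card ≤ k → (∃ x0 ∈ X, G.Adj w x0) →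
            (Y.filter (G.Adj w ·)).card ≤ 1 := by
          rintro X Y hXi hU hY ⟨x0, hx0, hwx0⟩
          have hsub : G.neighborFinset x0 ⊆ insert w (Y.filter (¬ G.Adj w ·)) := by
            intro z hz
            rw [SimpleGraph.mem_neighborFinset] at hz
            simp only [Finset.mem_insert, Finset.mem_filter]
            rcases hU z with h | h | h
            · exact absurd hz (hXi x0 hx0 z h)
            · exact Or.inr ⟨h, fun hwz => tri htf hwx0 hz hwz⟩
            · exact Or.inl h
          have h1 := (hdeg' x0).trans (Finset.card_le_card hsub)
          have h2 := Finset.card_insert_le w (Y.filter (¬ G.Adj w ·))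
          have h3 := Finset.card_filter_add_card_filter_not (s := Y) (G.Adj w ·)
          omega
        have k1 := key X Y hXi hU (by omega) hx0
        have k2 := key Y X hYi (fun z => by have := hU z; tauto) (by omega) hy0
        have hsub : G.neighborFinset w ⊆ (Y.filter (G.Adj w ·)) ∪ (X.filter (G.Adj w ·)) := by
          intro z hz
          rw [SimpleGraph.mem_neighborFinset] at hz
          simp only [Finset.mem_union, Finset.mem_filter]
          rcases hU z with h | h | h
          · exact Or.inr ⟨h, hz⟩
          · exact Or.inl ⟨h, hz⟩
          · exact absurd (h ▸ hz) (G.loopless.irrefl w)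
        have h1 := (hdeg' w).trans (Finset.card_le_card hsub)
        have h2 := Finset.card_union_le (Y.filter (G.Adj w ·)) (X.filter (G.Adj w ·))
        omega
      · refine bip_lemma k hk G hdeg htf hcard u X hXi ?_
        intro a ha b hb hab
        push Not at hy0
        rcases hU a with h | h | h
        · exact ha h
        · rcases hU b with h' | h' | h'
          · exact hb h'
          · exact hYi a h b h' hab
          · exact hy0 a h (h' ▸ hab.symm)
        · rcases hU b with h' | h' | h'
          · exact hb h'
          · exact hy0 b h' (h ▸ hab)
          · exact hab.ne (h.trans h'.symm)
    · refine bip_lemma k hk G hdeg htf hcard u Y hYi ?_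
      intro a ha b hb hab
      push Not at hx0
      rcases hU a with h | h | h
      · rcases hU b with h' | h' | h'
        · exact hXi a h b h' hab
        · exact hb h'
        · exact hx0 a h (h' ▸ hab.symm)
      · exact ha h
      · rcases hU b with h' | h' | h'
        · exact hx0 b h' (h ▸ hab)
        · exact hb h'
        · exact hab.ne (h.trans h'.symm)
  · push Not at hw
    exact bip_lemma k hk G hdeg htf hcard u X hXi (fun a ha b hb => hYi a (hw a ha) b (hw b hb))

theorem Cyc.congr {V : Type*} {G : SimpleGraph V} {f : ℤ → V} {c : ℕ} (h : Cyc G f c) {s t : ℤ}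
    (hst : (c : ℤ) ∣ s - t) : f s = f t := by
  obtain ⟨m, hm⟩ := hst
  rw [← h.per.int_mul m t]
  congr 1
  simp
  linarith

open Classical in
theorem Cyc.replace {V : Type*} {G : SimpleGraph V} {f : ℤ → V} {c : ℕ} (h : Cyc G f c) {x : V}
    (hx : x ∉ Set.range f) (j : ℤ) (h1 : G.Adj (f (j - 1)) x) (h2 : G.Adj x (f (j + 1))) :
    Cyc G (fun t => if (c : ℤ) ∣ t - j then x else f t) c where
  three := h.three
  per := fun t => by
    have : (c : ℤ) ∣ t + c - j ↔ (c : ℤ) ∣ t - j := by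
      rw [show t + c - j = (t - j) + c by ring]; simp
    simp only [this, h.per t]
  adj := fun t => by
    have h3 := h.three
    have hne : ¬ (c : ℤ) ∣ 1 := fun hd => by
      have := Int.le_of_dvd (by norm_num) hd
      omega
    by_cases ht : (c : ℤ) ∣ t - j
    · have ht' : ¬ (c : ℤ) ∣ t + 1 - j := fun hd => hne (by
        have := dvd_sub hd ht
        rwa [show t + 1 - j - (t - j) = 1 by ring] at this)
      simp only [ht, ht', if_true, if_false]
      rw [h.congr (s := t + 1) (t := j + 1) (by convert ht using 1; ring)]
      exact h2
    · by_cases ht' : (c : ℤ) ∣ t + 1 - j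
      · simp only [ht, ht', if_true, if_false]
        rw [h.congr (s := t) (t := j - 1) (by convert ht' using 1; ring)]
        exact h1
      · simp only [ht, ht', if_false]
        exact h.adj t
  inj := fun s t hst => by
    by_cases hs : (c : ℤ) ∣ s - j <;> by_cases ht : (c : ℤ) ∣ t - j <;> 
      simp only [hs, ht, if_true, if_false] at hst
    · have := dvd_sub hs ht
      rwa [show s - j - (t - j) = s - t by ring] at this
    · exact absurd ⟨_, hst.symm⟩ hx
    · exact absurd ⟨_, hst⟩ hx
    · exact h.inj _ _ hst

theorem even_lemma (k : ℕ) (S : Finset ℕ) (hS : S ⊆ Finset.Ico 0 (2 * k - 1))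
    (hnc : ∀ i ∈ S, i + 1 ∉ S) (hc : k ≤ S.card) : ∀ t, t ∈ S ↔ ∃ i < k, t = 2 * i := by
  have ev : ∀ i < k, 2 * i ∈ S := by
    intro i hi
    by_contra hcon
    have h0 : S = (S.filter (· < 2 * i)) ∪ (S.filter (2 * i + 1 ≤ ·)) := by
      ext t
      simp only [Finset.mem_union, Finset.mem_filter]
      constructor
      · intro ht
        have : t ≠ 2 * i := fun h => hcon (h ▸ ht)
        rcases lt_or_ge t (2 * i) with h | h
        · exact Or.inl ⟨ht, h⟩
        · exact Or.inr ⟨ht, by omega⟩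
      · rintro (h | h) <;> exact h.1
    have h1 := nc_lemma (S.filter (· < 2 * i)) 0 (2 * i) (by
      intro t ht; simp at ht ⊢; exact ht.2) (by
      intro t ht ht'; exact hnc t (Finset.mem_filter.1 ht).1 (Finset.mem_filter.1 ht').1)
    have h2 := nc_lemma (S.filter (2 * i + 1 ≤ ·)) (2 * i + 1) (2 * k - 1) (by
      intro t ht
      have h1 := Finset.mem_filter.1 ht
      have := Finset.mem_Ico.1 (hS h1.1)
      exact Finset.mem_Ico.2 ⟨h1.2, this.2⟩) (by
      intro t ht ht'; exact hnc t (Finset.mem_filter.1 ht).1 (Finset.mem_filter.1 ht').1)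
    have h3 := Finset.card_union_le (S.filter (· < 2 * i)) (S.filter (2 * i + 1 ≤ ·))
    rw [← h0] at h3
    omega
  intro t
  constructor
  · intro ht
    have := Finset.mem_Ico.1 (hS ht)
    rcases Nat.even_or_odd' t with ⟨i, h | h⟩
    · exact ⟨i, by omega, h⟩
    · exact absurd (h ▸ ht) (hnc _ (ev i (by omega)))
  · rintro ⟨i, hi, rfl⟩
    exact ev i hi

theorem pat_lemma {V : Type*} [Fintype V] (k : ℕ) (hk : 3 ≤ k)
    (G : SimpleGraph V) [DecidableRel G.Adj]
    (hdeg : ∀ v : V, k ≤ G.degree v) (htf : G.CliqueFree 3)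
    {f : ℤ → V} {c : ℕ} (h : Cyc G f c) (hc : c ≤ 2 * k + 1) {x : V} 
    (hN : ∀ y, G.Adj x y → y ∈ Set.range f) :
    (c = 2 * k ∨ c = 2 * k + 1) ∧ 
      ∃ r : ℤ, ∀ t : ℕ, t < c → (G.Adj x (f (r + t)) ↔ ∃ i < k, t = 2 * i) := by
  classical
  have hcard : ∀ r : ℤ, k ≤ ((Finset.Ico 0 c).filter (fun t : ℕ => G.Adj x (f (r + t)))).card := by
    intro r
    have := h.card_le (G.neighborFinset x) (by simpa using hN) r
    simp only [SimpleGraph.mem_neighborFinset] at this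
    rw [SimpleGraph.card_neighborFinset_eq_degree] at this
    exact (hdeg x).trans this
  have hnc : ∀ j : ℤ, G.Adj x (f j) → ¬ G.Adj x (f (j + 1)) := fun j h1 h2 => tri htf h1 (h.adj j) h2
  have hnc' : ∀ (r : ℤ), ∀ i ∈ ((Finset.Ico 0 c).filter (fun t : ℕ => G.Adj x (f (r + t)))),
      i + 1 ∉ ((Finset.Ico 0 c).filter (fun t : ℕ => G.Adj x (f (r + t)))) := by
    intro r i hi hi'
    have h1 := (Finset.mem_filter.1 hi).2
    have h2 := (Finset.mem_filter.1 hi').2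
    refine hnc _ h1 ?_
    convert h2 using 2
    push_cast; ring
  have fin : ∀ r : ℤ, ((Finset.Ico 0 c).filter (fun t : ℕ => G.Adj x (f (r + t)))) ⊆ 
      Finset.Ico 0 (2 * k - 1) → 
      ∃ r : ℤ, ∀ t : ℕ, t < c → (G.Adj x (f (r + t)) ↔ ∃ i < k, t = 2 * i) := by
    intro r hs
    refine ⟨r, fun t ht => ?_⟩
    rw [← even_lemma k _ hs (hnc' r) (hcard r) t]
    simp [ht]
  by_cases hc2 : c = 2 * k + 1
  · refine ⟨Or.inr hc2, ?_⟩
    have : ∃ j : ℤ, ¬ G.Adj x (f j) ∧ ¬ G.Adj x (f (j + 1)) := by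
      by_contra hcon
      push Not at hcon
      have hst : ∀ j : ℤ, G.Adj x (f (j + 1)) ↔ ¬ G.Adj x (f j) := fun j => 
        ⟨fun h1 h2 => hnc j h2 h1, hcon j⟩
      have h2 : ∀ m : ℕ, G.Adj x (f (2 * m : ℕ)) ↔ G.Adj x (f 0) := by
        intro m
        induction m with
        | zero => simp
        | succ m ih =>
          rw [← ih]
          have e : ((2 * (m + 1) : ℕ) : ℤ) = ((2 * m : ℕ) : ℤ) + 1 + 1 := by push_cast; ring
          rw [e, hst, hst, not_not]
      have h3 := h2 k
      have h4 := hst (2 * k : ℕ)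
      have e : f (((2 * k : ℕ) : ℤ) + 1) = f 0 := by
        rw [← h.per 0]; congr 1; rw [hc2]; push_cast; ring
      rw [e, h3] at h4
      tauto
    obtain ⟨j, hj1, hj2⟩ := this
    refine fin (j + 2) ?_
    intro t ht
    obtain ⟨h1, h2⟩ := Finset.mem_filter.1 ht
    rw [Finset.mem_Ico] at h1 ⊢
    refine ⟨by omega, ?_⟩
    by_contra hcon
    have h3 : t = 2 * k - 1 ∨ t = 2 * k := by omega
    rcases h3 with h3 | h3
    · apply hj1
      rw [← h.per j]
      convert h2 using 2; omega
    · apply hj2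
      rw [← h.per (j + 1)]
      convert h2 using 2; omega
  · obtain ⟨t0, ht0⟩ : ((Finset.Ico 0 c).filter (fun t : ℕ => G.Adj x (f ((0 : ℤ) + t)))).Nonempty :=
      Finset.card_pos.1 (by have := hcard 0; omega)
    have ht0 := (Finset.mem_filter.1 ht0).2
    set r : ℤ := 0 + t0 with hr
    have hsub : ((Finset.Ico 0 c).filter (fun t : ℕ => G.Adj x (f (r + t)))) ⊆ Finset.Ico 0 (c - 1) := by
      intro t ht
      obtain ⟨h1, h2⟩ := Finset.mem_filter.1 ht
      rw [Finset.mem_Ico] at h1 ⊢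
      refine ⟨by omega, ?_⟩
      by_contra hcon
      apply hnc _ h2
      rw [← h.per r] at ht0
      convert ht0 using 2; omega
    have h1 := nc_lemma _ 0 (c - 1) hsub (hnc' r)
    have h2 := hcard r
    have h3 := h.three
    have h4 : c = 2 * k := by omega
    exact ⟨Or.inl h4, fin r (by rw [← h4]; exact hsub)⟩

theorem pat2k {V : Type*} [Fintype V] (k : ℕ) (hk : 3 ≤ k)
    (G : SimpleGraph V) [DecidableRel G.Adj]
    (hdeg : ∀ v : V, k ≤ G.degree v) (htf : G.CliqueFree 3)
    {f : ℤ → V} (h : Cyc G f (2 * k)) {x : V}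
    (hN : ∀ y, G.Adj x y → y ∈ Set.range f) :
    ∃ r : ℤ, ∀ t : ℤ, G.Adj x (f t) ↔ Even (t - r) := by
  obtain ⟨-, r, hr⟩ := pat_lemma k hk G hdeg htf h (by omega) hN
  refine ⟨r, fun t => ?_⟩
  have hp : (0 : ℤ) < (2 * k : ℕ) := by omega
  have h1 := Int.emod_nonneg (t - r) hp.ne'
  have h2 := Int.emod_lt_of_pos (t - r) hp
  have h3 := Int.emod_add_mul_ediv (t - r) (2 * k : ℕ)
  obtain ⟨s, hs⟩ := Int.eq_ofNat_of_zero_le h1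
  rw [hs] at h2 h3
  have h4 : f t = f (r + s) := h.congr ⟨(t - r) / (2 * k : ℕ), by linarith⟩
  rw [h4, hr s (by omega)]
  obtain ⟨m, h5⟩ : ∃ m : ℤ, t - r = s + 2 * m := by
    refine ⟨(k : ℤ) * ((t - r) / (2 * k : ℕ)), ?_⟩
    generalize (t - r) / ((2 * k : ℕ) : ℤ) = q at h3 ⊢
    push_cast at h3
    linarith
  rw [h5]
  constructor
  · rintro ⟨i, hi, rfl⟩
    exact ⟨i + m, by push_cast; ring⟩
  · rintro ⟨n, hn⟩
    exact ⟨s / 2, by omega, by omega⟩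

theorem case_even {V : Type*} [Fintype V] (k : ℕ) (hk : 3 ≤ k)
    (G : SimpleGraph V) [DecidableRel G.Adj]
    (h2 : TwoConnected G) (hdeg : ∀ v : V, k ≤ G.degree v) (htf : G.CliqueFree 3)
    {f : ℤ → V} (h : Cyc G f (2 * k)) (hm : Mx G (2 * k)) {x : V} (hx : x ∉ Set.range f) :
    ∃ n : ℕ, k ≤ n ∧ Nonempty (G ≃g completeBipartiteGraph (Fin k) (Fin n)) := by
  classical
  have hoff : ∀ {g : ℤ → V}, Cyc G g (2 * k) → ∀ v, v ∉ Set.range g → ∀ y, G.Adj v y →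
      y ∈ Set.range g := fun hg v hv y hvy => by
    by_contra hy
    exact off_indep k hk G h2 hdeg htf hg hm (by omega) hv hy hvy
  obtain ⟨r, hr⟩ := pat2k k hk G hdeg htf h (hoff h x hx)
  have hodd : ∀ j : ℤ, ¬ Even (j - r) → ∀ w, G.Adj (f j) w ↔ G.Adj x w := by
    intro j hj
    have hj1 : G.Adj x (f (j - 1)) := (hr _).2 (by
      rw [Int.not_even_iff_odd] at hj
      obtain ⟨m, hm⟩ := hj
      exact ⟨m, by omega⟩)
    have hj2 : G.Adj x (f (j + 1)) := (hr _).2 (by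
      rw [Int.not_even_iff_odd] at hj
      obtain ⟨m, hm⟩ := hj
      exact ⟨m + 1, by omega⟩)
    have hf' := h.replace hx j hj1.symm hj2
    have hd : ∀ t : ℤ, Even (t - r) → ¬ (((2 * k : ℕ) : ℤ) ∣ t - j) := by
      rintro t ⟨m, hm⟩ ⟨q, hq⟩
      refine hj ⟨m - k * q, ?_⟩
      push_cast at hq
      linarith
    have hy : f j ∉ Set.range (fun t => if ((2 * k : ℕ) : ℤ) ∣ t - j then x else f t) := by
      rintro ⟨t, ht⟩
      simp only at ht
      split_ifs at ht with h1
      · exact hx ⟨j, ht.symm⟩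
      · exact h1 (h.inj _ _ ht)
    have hN := hoff hf' _ hy
    obtain ⟨r', hr'⟩ := pat2k k hk G hdeg htf hf' hN
    have hjj := (hr' (j - 1)).1 (by
      rw [if_neg (hd _ ((hr _).1 hj1))]
      have := h.adj (j - 1)
      rw [sub_add_cancel] at this
      exact this.symm)
    have hrr : ∀ t : ℤ, Even (t - r') ↔ Even (t - r) := by
      intro t
      obtain ⟨m, hm⟩ := hjj
      obtain ⟨n, hn⟩ := (hr _).1 hj1
      constructor
      · rintro ⟨q, hq⟩; exact ⟨q - m + n, by omega⟩
      · rintro ⟨q, hq⟩; exact ⟨q - n + m, by omega⟩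
    intro w
    constructor
    · intro hw
      obtain ⟨t, rfl⟩ := hN w hw
      simp only at hw ⊢
      have h3 := (hrr t).1 ((hr' t).1 hw)
      rw [if_neg (hd _ h3)]
      exact (hr t).2 h3
    · intro hw
      obtain ⟨t, rfl⟩ := hoff h x hx w hw
      have h3 := (hr t).1 hw
      have h4 := (hr' t).2 ((hrr t).2 h3)
      rwa [if_neg (hd _ h3)] at h4
  have hoffv : ∀ v, v ∉ Set.range f → ∀ w, G.Adj v w ↔ G.Adj x w := by
    intro v hv
    obtain ⟨r', hr'⟩ := pat2k k hk G hdeg htf h (hoff h v hv)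
    have hpar : Even (r' - r) := by
      by_contra hcon
      have h3 := (hr' r').2 (by simp)
      have h4 := (hodd r' hcon v).1 h3.symm
      exact hv (hoff h x hx v h4)
    intro w
    have key : ∀ t, G.Adj v (f t) ↔ G.Adj x (f t) := by
      intro t
      rw [hr, hr']
      obtain ⟨m, hm⟩ := hpar
      constructor
      · rintro ⟨q, hq⟩; exact ⟨q + m, by omega⟩
      · rintro ⟨q, hq⟩; exact ⟨q - m, by omega⟩
    constructor
    · intro hw
      obtain ⟨t, rfl⟩ := hoff h v hv w hw
      exact (key t).1 hw
    · intro hw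
      obtain ⟨t, rfl⟩ := hoff h x hx w hw
      exact (key t).2 hw
  have hcard : (G.neighborFinset x).card ≤ k := by
    have : G.neighborFinset x ⊆ (Finset.range k).image (fun i : ℕ => f (r + 2 * i)) := by
      intro w hw
      rw [SimpleGraph.mem_neighborFinset] at hw
      obtain ⟨t, ht, rfl⟩ := h.mem_range (hoff h x hx w hw) r
      obtain ⟨m, hm⟩ := (hr _).1 hw
      refine Finset.mem_image.2 ⟨t / 2, by simp; omega, ?_⟩
      congr 1
      omega
    calc _ ≤ _ := Finset.card_le_card this
      _ ≤ _ := Finset.card_image_le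
      _ = k := by simp
  refine iso_lemma k hk G hdeg htf (G.neighborFinset x) (le_antisymm hcard ?_) ?_
  · rw [SimpleGraph.card_neighborFinset_eq_degree]; exact hdeg x
  · intro v hv w
    rw [SimpleGraph.mem_neighborFinset] at hv ⊢
    by_cases hvr : v ∈ Set.range f
    · obtain ⟨t, rfl⟩ := hvr
      exact hodd t (fun he => hv ((hr t).2 he)) w
    · exact hoffv v hvr w

theorem pq_lemma {V : Type*} [Fintype V] [DecidableEq V] (k : ℕ) (hk : 3 ≤ k)
    (G : SimpleGraph V) [DecidableRel G.Adj]
    (h2 : TwoConnected G) (hdeg : ∀ v : V, k ≤ G.degree v) (htf : G.CliqueFree 3)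
    {f : ℤ → V} (h : Cyc G f (2 * k + 1)) (hm : Mx G (2 * k + 1)) {x : V} (hx : x ∉ Set.range f)
    (hA : ∀ i : ℤ, 0 ≤ i → i < k → G.Adj x (f (2 * i))) :
    k - 1 ≤ (G.neighborFinset (f (2 * k - 1)) ∩ G.neighborFinset x).card := by
  have hl : G.Adj x (f (2 * k - 2)) := by
    have := hA (k - 1) (by omega) (by omega)
    rwa [show 2 * ((k : ℤ) - 1) = 2 * k - 2 by ring] at this
  have ep : G.Adj (f (2 * k - 2)) (f (2 * k - 1)) := by
    have := h.adj (2 * k - 2)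
    rwa [show 2 * (k : ℤ) - 2 + 1 = 2 * k - 1 by ring] at this
  have eq : G.Adj (f (2 * k - 1)) (f (2 * k)) := by
    have := h.adj (2 * k - 1)
    rwa [show 2 * (k : ℤ) - 1 + 1 = 2 * k by ring] at this
  have hsub : G.neighborFinset (f (2 * k - 1)) ⊆
      insert (f (2 * k)) (G.neighborFinset (f (2 * k - 1)) ∩ G.neighborFinset x) := by
    intro w hw
    rw [SimpleGraph.mem_neighborFinset] at hw
    simp only [Finset.mem_insert, Finset.mem_inter, SimpleGraph.mem_neighborFinset]
    by_cases hwr : w ∈ Set.range f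
    · obtain ⟨t, ht, rfl⟩ := h.mem_range hwr 0
      rw [zero_add] at hw ⊢
      by_cases h1 : t = 2 * k
      · left; rw [h1]; push_cast; rfl
      right
      refine ⟨hw, ?_⟩
      rcases Nat.even_or_odd' t with ⟨i, h3 | h3⟩
      · rw [h3]; push_cast; exact hA i (by omega) (by omega)
      · exfalso
        by_cases h4 : t + 1 = 2 * k
        · apply G.loopless.irrefl (f (2 * k - 1))
          convert hw using 2
          omega
        · refine cross_adj h hm (i := 2 * i) (j := 2 * k - 2) hx (hA i (by omega) (by omega)) hl
            (by omega) (by push_cast; omega) ?_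
          rw [show 2 * (k : ℤ) - 2 + 1 = 2 * k - 1 by ring]
          rw [h3] at hw
          push_cast at hw
          exact hw.symm
    · exfalso
      have hwx : w ≠ x := fun e => tri htf hl ep (e ▸ hw.symm)
      have hwr' : ∀ y, G.Adj w y → y ∈ Set.range f := fun y hy => by
        by_contra hcon
        exact off_indep k hk G h2 hdeg htf h hm (by omega) hwr hcon hy
      have hp1 : (2 * (k : ℤ) - 2) + ((1 : ℕ) : ℤ) = 2 * k - 1 := by push_cast; ring
      have hsub : G.neighborFinset w ⊆
          ((Finset.range (k - 1)).erase 1).image (fun i : ℕ => f (2 * i)) ∪ {f (2 * k - 1)} := by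
        intro y hy
        rw [SimpleGraph.mem_neighborFinset] at hy
        obtain ⟨t, ht, rfl⟩ := h.mem_range (hwr' y hy) 0
        rw [zero_add] at hy ⊢
        rw [Finset.mem_union, Finset.mem_singleton]
        rcases Nat.even_or_odd' t with ⟨i, h3 | h3⟩
        · left
          rw [h3] at hy
          push_cast at hy
          refine Finset.mem_image.2 ⟨i, ?_, by rw [h3]; push_cast; rfl⟩
          rw [Finset.mem_erase, Finset.mem_range]
          refine ⟨?_, ?_⟩
          · rintro rfl
            refine cross_off h hm (i := 0) (j := 2 * k - 2) hx (by simpa using hA 0 le_rfl (by omega))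
              hl 2 1 (by omega) (by push_cast; omega) (by omega) (by push_cast; omega) (by omega)
              hwr hwx (by simpa using hy) ?_
            rw [hp1]; exact hw.symm
          · by_contra hcon
            have : i = k - 1 ∨ i = k := by omega
            rcases this with h4 | h4
            · refine tri htf ep hw ?_
              have e : (2 * (i : ℤ)) = 2 * k - 2 := by omega
              rw [e] at hy
              exact hy.symm
            · rw [h4] at hy
              exact tri htf eq hy.symm hw
        · right
          by_cases h4 : t + 1 = 2 * k
          · congr 1; omega
          · exfalso
            refine cross_off h hm (i := 2 * i) (j := 2 * k - 2) hx (hA i (by omega) (by omega))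
              hl 1 1 (by omega) (by push_cast; omega) (by omega) (by push_cast; omega) (by omega)
              hwr hwx (by rw [h3] at hy; push_cast at hy ⊢; exact hy) ?_
            rw [hp1]; exact hw.symm
      have h5 := Finset.card_le_card hsub
      rw [SimpleGraph.card_neighborFinset_eq_degree] at h5
      have h6 := Finset.card_union_le (((Finset.range (k - 1)).erase 1).image (fun i : ℕ => f (2 * i))) {f (2 * k - 1)}
      have h7 : (((Finset.range (k - 1)).erase 1).image (fun i : ℕ => f (2 * i))).card ≤ k - 2 := by
        refine Finset.card_image_le.trans ?_
        rw [Finset.card_erase_of_mem (by simp; omega), Finset.card_range]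
        omega
      have h8 := hdeg w
      rw [Finset.card_singleton] at h6
      omega
  have h5 := Finset.card_le_card hsub
  rw [SimpleGraph.card_neighborFinset_eq_degree] at h5
  have h6 := Finset.card_insert_le (f (2 * k)) (G.neighborFinset (f (2 * k - 1)) ∩ G.neighborFinset x)
  have := hdeg (f (2 * k - 1))
  omega

theorem case_odd {V : Type*} [Fintype V] (k : ℕ) (hk : 3 ≤ k)
    (G : SimpleGraph V) [DecidableRel G.Adj]
    (h2 : TwoConnected G) (hdeg : ∀ v : V, k ≤ G.degree v) (htf : G.CliqueFree 3)
    {f : ℤ → V} (h : Cyc G f (2 * k + 1)) (hm : Mx G (2 * k + 1)) {x : V} (hx : x ∉ Set.range f) :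
    False := by
  classical
  have hN : ∀ y, G.Adj x y → y ∈ Set.range f := fun y hy => by
    by_contra hcon
    exact off_indep k hk G h2 hdeg htf h hm (by omega) hx hcon hy
  obtain ⟨-, r, hr⟩ := pat_lemma k hk G hdeg htf h le_rfl hN
  have hA : ∀ i : ℤ, 0 ≤ i → i < k → G.Adj x (f (2 * i + r)) := by
    intro i h0 h1
    obtain ⟨n, rfl⟩ := Int.eq_ofNat_of_zero_le h0
    have := (hr (2 * n) (by omega)).2 ⟨n, by omega, rfl⟩
    push_cast at this
    rwa [add_comm]
  have hcard : (G.neighborFinset x).card ≤ k := by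
    have : G.neighborFinset x ⊆ (Finset.range k).image (fun i : ℕ => f (r + 2 * i)) := by
      intro w hw
      rw [SimpleGraph.mem_neighborFinset] at hw
      obtain ⟨t, ht, rfl⟩ := h.mem_range (hN w hw) r
      obtain ⟨i, hi, rfl⟩ := (hr t ht).1 hw
      refine Finset.mem_image.2 ⟨i, by simpa using hi, ?_⟩
      push_cast; rfl
    calc _ ≤ _ := Finset.card_le_card this
      _ ≤ _ := Finset.card_image_le
      _ = k := by simp
  have hp := pq_lemma k hk G h2 hdeg htf (h.shift r) hm (x := x)
    (by rintro ⟨t, ht⟩; exact hx ⟨_, ht⟩) hA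
  have hq := pq_lemma k hk G h2 hdeg htf ((h.shift (r + (2 * k - 2))).neg) hm (x := x)
    (by rintro ⟨t, ht⟩; exact hx ⟨_, ht⟩) (by
      intro i h0 h1
      have := hA (k - 1 - i) (by omega) (by omega)
      convert this using 2
      ring)
  have e1 : G.Adj (f (2 * k - 1 + r)) (f (-(2 * k - 1) + (r + (2 * k - 2)))) := by
    have h3 := h.adj (2 * k - 1 + r)
    have h4 : f (-(2 * k - 1) + (r + (2 * k - 2))) = f (2 * k - 1 + r + 1) :=
      h.congr ⟨-1, by push_cast; ring⟩
    rwa [h4]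
  have hd : Disjoint (G.neighborFinset (f (2 * k - 1 + r)) ∩ G.neighborFinset x)
      (G.neighborFinset (f (-(2 * k - 1) + (r + (2 * k - 2)))) ∩ G.neighborFinset x) := by
    rw [Finset.disjoint_left]
    intro w h3 h4
    simp only [Finset.mem_inter, SimpleGraph.mem_neighborFinset] at h3 h4
    exact tri htf e1 h4.1 h3.1
  have h5 := Finset.card_le_card (Finset.union_subset
    (Finset.inter_subset_right (s₁ := G.neighborFinset (f (2 * k - 1 + r))) (s₂ := G.neighborFinset x))
    (Finset.inter_subset_right (s₁ := G.neighborFinset (f (-(2 * k - 1) + (r + (2 * k - 2)))))))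
  rw [Finset.card_union_of_disjoint hd] at h5
  omega

/-- For `k ≥ 3`, a 2-connected triangle-free graph of minimum degree at least `k` contains a
cycle of length at least `2k + 2`, unless it is isomorphic to `K_{k,n}` for some `n ≥ k`. -/
theorem stmt_11 {V : Type*} [Fintype V] (k : ℕ) (hk : 3 ≤ k)
    (G : SimpleGraph V) [DecidableRel G.Adj]
    (h2 : TwoConnected G) (hdeg : ∀ v : V, k ≤ G.degree v) (htf : G.CliqueFree 3) :
    (∃ n : ℕ, k ≤ n ∧ Nonempty (G ≃g completeBipartiteGraph (Fin k) (Fin n))) ∨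
      ∃ ℓ : ℕ, 2 * k + 2 ≤ ℓ ∧ HasCycleLength G ℓ := by
  classical
  by_cases hno : ∃ ℓ : ℕ, 2 * k + 2 ≤ ℓ ∧ HasCycleLength G ℓ
  · exact Or.inr hno
  left
  push Not at hno
  have hcyc : ∃ a b l, PathL G a b l ∧ G.Adj b a ∧ 3 ≤ l.length := by
    obtain ⟨v⟩ : Nonempty V := Fintype.card_pos_iff.1 (by have := h2.1; omega)
    obtain ⟨a, b, m, h3, -, -, h4, -⟩ := exists_longest G ∅ v v [v] (PathL.single G v) (by simp)
    have hda := hdeg a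
    rw [← SimpleGraph.card_neighborFinset_eq_degree] at hda
    obtain ⟨b', l', h5, -, h6, h7⟩ := end_lemma htf h3 (G.neighborFinset a)
      (Finset.card_pos.1 (by omega)) (by
        intro v hv
        rw [SimpleGraph.mem_neighborFinset] at hv
        exact ⟨hv, h4 v (by simp) hv⟩)
    exact ⟨a, b', l', h5, h7, by omega⟩
  obtain ⟨c, ⟨a, b, l, hl, hab, h3, hlc⟩, hm⟩ : ∃ c, (∃ a b l, PathL G a b l ∧ G.Adj b a ∧ 3 ≤ l.length ∧ l.length = c) ∧
      Mx G c := by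
    let P : ℕ → Prop := fun n => ∃ a b l, PathL G a b l ∧ G.Adj b a ∧ 3 ≤ l.length ∧ l.length = n
    have hb : ∀ n, P n → n ≤ Fintype.card V := by
      rintro n ⟨a, b, m, hm, _, _, rfl⟩
      exact hm.2.1.length_le_card
    obtain ⟨a, b, l, h1, h3, h4⟩ := hcyc
    have hP : P l.length := ⟨a, b, l, h1, h3, h4, rfl⟩
    refine ⟨_, Nat.findGreatest_spec (P := P) (hb _ hP) hP, ?_⟩
    intro a b m h5 h6 h7
    have hQ : P m.length := ⟨a, b, m, h5, h6, h7, rfl⟩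
    exact Nat.le_findGreatest (hb _ hQ) hQ
  subst hlc
  obtain ⟨f, hf, -, -⟩ := Cyc.of_path hl hab h3
  have hc : l.length ≤ 2 * k + 1 := by
    by_contra hcon
    exact hno _ (by omega) (hl.hasCycle hab h3)
  by_cases hall : ∀ v, v ∈ Set.range f
  · refine small_lemma k hk G hdeg htf ?_ a
    have h4 := hf.card_le Finset.univ (fun v _ => hall v) 0
    have h5 := Finset.card_filter_le (Finset.Ico 0 l.length) (fun t : ℕ => f (0 + t) ∈ Finset.univ)
    rw [Nat.card_Ico] at h5
    rw [Finset.card_univ] at h4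
    omega
  · push Not at hall
    obtain ⟨x, hx⟩ := hall
    have hN : ∀ y, G.Adj x y → y ∈ Set.range f := fun y hy => by
      by_contra hcon
      exact off_indep k hk G h2 hdeg htf hf hm hc hx hcon hy
    rcases (pat_lemma k hk G hdeg htf hf hc hN).1 with h4 | h4
    · rw [h4] at hf hm
      exact case_even k hk G h2 hdeg htf hf hm hx
    · rw [h4] at hf hm
      exact (case_odd k hk G h2 hdeg htf hf hm hx).elim
end
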